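/- Let b be a rational function in the closed unit ball of H∞ with ‖b‖∞ = 1 that is not a finite Blaschke product, with associated polynomial a₁. For every inner function I, the subspaces a₁IH² and a₁K_I are closed in H(b), and the orthogonal complement of a₁IH² in H(b) (with respect to the equivalent inner product) equals a₁K_I ⊕ P_{N−1}. In particular, when I is a finite Blaschke product, a₁IH² has finite codimension in H(b). -/

import Mathlib

open Complex MeasureTheory Set Filter

noncomputable section

attribute [local instance] Classical.propDecidable

/-- The open unit disk in `ℂ`. -/
def unitDisk : Set ℂ := Metric.ball 0 1

/-- The unit circle in `ℂ`. -/
def unitCircle : Set ℂ := Metric.sphere 0 1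

/-- Membership in `H^∞`: analytic and bounded on the unit disk. -/
def MemHinf (f : ℂ → ℂ) : Prop :=
  DifferentiableOn ℂ f unitDisk ∧ ∃ C : ℝ, ∀ z ∈ unitDisk, ‖f z‖ ≤ C

/-- Membership in the closed unit ball of `H^∞`. -/
def MemBallHinf (f : ℂ → ℂ) : Prop :=
  DifferentiableOn ℂ f unitDisk ∧ ∀ z ∈ unitDisk, ‖f z‖ ≤ 1

/-- `f` agrees on the closed unit disk with a rational function without poles there. -/
def IsRationalOnDisk (f : ℂ → ℂ) : Prop :=
  ∃ P Q : Polynomial ℂ, ∀ z ∈ Metric.closedBall (0:ℂ) 1,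
    Q.eval z ≠ 0 ∧ f z = P.eval z / Q.eval z

/-- `f` is a finite Blaschke product (multiplicities are encoded by repetition). -/
def IsFiniteBlaschke (f : ℂ → ℂ) : Prop :=
  ∃ (γ : ℂ) (k : ℕ) (lam : Fin k → ℂ), ‖γ‖ = 1 ∧ (∀ i, lam i ∈ unitDisk) ∧
    ∀ z ∈ unitDisk, f z = γ * ∏ i, (z - lam i) / (1 - (starRingEnd ℂ) (lam i) * z)

/-- The `k`-th Taylor coefficient of `f` at the origin. -/
def taylorCoeff (f : ℂ → ℂ) (k : ℕ) : ℂ := iteratedDeriv k f 0 / k.factorial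

/-- Membership in the Hardy space `H²` (square-summable Taylor coefficients). -/
def MemH2 (f : ℂ → ℂ) : Prop :=
  DifferentiableOn ℂ f unitDisk ∧ Summable fun k => ‖taylorCoeff f k‖ ^ 2

/-- The squared `H²` norm. -/
def h2NormSq (f : ℂ → ℂ) : ℝ := ∑' k, ‖taylorCoeff f k‖ ^ 2

/-- The `H²` inner product. -/
def h2Inner (f g : ℂ → ℂ) : ℂ :=
  ∑' k, (starRingEnd ℂ) (taylorCoeff f k) * taylorCoeff g k

/-- The polynomial `a₁(z) = ∏ⱼ (z − ξⱼ)^{mⱼ}`. -/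
def a1fun {n : ℕ} (ξ : Fin n → ℂ) (m : Fin n → ℕ) : ℂ → ℂ :=
  fun z => ∏ j, (z - ξ j) ^ (m j)

/-- A decomposition `f = a₁ g + q` with `g ∈ H²`, `deg q ≤ N − 1`, witnessing membership
in `H(b) = a₁H² ⊕ P_{N−1}`. -/
def HbDecompOf {n : ℕ} (ξ : Fin n → ℂ) (m : Fin n → ℕ)
    (f g : ℂ → ℂ) (q : Polynomial ℂ) : Prop :=
  MemH2 g ∧ q.degree < ((∑ j, m j : ℕ) : WithBot ℕ) ∧
    ∀ z ∈ unitDisk, f z = a1fun ξ m z * g z + q.eval z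

/-- Membership in `H(b) = a₁ H² ⊕ P_{N−1}` (description of `H(b)` for `b` rational,
not a finite Blaschke product, whose pythagorean mate has boundary zeros `ξ` with
multiplicities `m`). -/
def MemHb {n : ℕ} (ξ : Fin n → ℂ) (m : Fin n → ℕ) (f : ℂ → ℂ) : Prop :=
  ∃ gq : (ℂ → ℂ) × Polynomial ℂ, HbDecompOf ξ m f gq.1 gq.2

/-- The (unique) decomposition of a member of `H(b)`. -/
def hbDecomp {n : ℕ} (ξ : Fin n → ℂ) (m : Fin n → ℕ) (f : ℂ → ℂ) :
    (ℂ → ℂ) × Polynomial ℂ :=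
  if h : MemHb ξ m f then h.choose else (0, 0)

/-- The squared norm `⦀a₁g + q⦀² = ‖g‖²_{H²} + ‖q‖²_{H²}` on `H(b)`. -/
def hbNormSq {n : ℕ} (ξ : Fin n → ℂ) (m : Fin n → ℕ) (f : ℂ → ℂ) : ℝ :=
  h2NormSq (hbDecomp ξ m f).1 + h2NormSq fun z => ((hbDecomp ξ m f).2).eval z

/-- The inner product on `H(b)` induced by the decomposition. -/
def hbInner {n : ℕ} (ξ : Fin n → ℂ) (m : Fin n → ℕ) (f g : ℂ → ℂ) : ℂ :=
  h2Inner (hbDecomp ξ m f).1 (hbDecomp ξ m g).1 +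
    h2Inner (fun z => ((hbDecomp ξ m f).2).eval z)
      (fun z => ((hbDecomp ξ m g).2).eval z)

/-- The Stolz angle (non-tangential approach region) at a boundary point `ξ`. -/
def stolzAngle (ξ : ℂ) (M : ℝ) : Set ℂ := {z ∈ unitDisk | ‖z - ξ‖ ≤ M * (1 - ‖z‖)}

/-- `f` has non-tangential limit `L` at `ξ`. -/
def NTLimit (f : ℂ → ℂ) (ξ L : ℂ) : Prop :=
  ∀ M : ℝ, 1 < M → Tendsto f (nhdsWithin ξ (stolzAngle ξ M)) (nhds L)

/-- Radial boundary value of `f` at `ζ` (junk value if the radial limit does not exist). -/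
def bdryVal (f : ℂ → ℂ) (ζ : ℂ) : ℂ :=
  limUnder (nhdsWithin (1:ℝ) (Set.Iio 1)) fun r : ℝ => f ((r : ℂ) * ζ)

/-- The full setting: `b` is a rational function in the closed unit ball of `H^∞` with
`‖b‖_∞ = 1` which is not a finite Blaschke product; `a` is its pythagorean mate (rational,
outer — i.e. zero-free on the disk —, `a(0) > 0`, `|a|² + |b|² = 1` on the circle); the
`ξ j` are the distinct zeros of `a` on the unit circle, with multiplicities `m j`. -/
structure RationalSetting (b a : ℂ → ℂ) (n : ℕ) (ξ : Fin n → ℂ) (m : Fin n → ℕ) :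
    Prop where
  b_diff : DifferentiableOn ℂ b unitDisk
  b_rat : IsRationalOnDisk b
  b_le_one : ∀ z ∈ unitDisk, ‖b z‖ ≤ 1
  b_norm_one : sSup ((fun z => ‖b z‖) '' unitDisk) = 1
  b_not_fbp : ¬ IsFiniteBlaschke b
  a_diff : DifferentiableOn ℂ a unitDisk
  a_rat : IsRationalOnDisk a
  a_outer : ∀ z ∈ unitDisk, a z ≠ 0
  a_zero_pos : 0 < (a 0).re ∧ (a 0).im = 0
  pyth : ∀ ζ ∈ unitCircle, ‖a ζ‖ ^ 2 + ‖b ζ‖ ^ 2 = 1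
  zeros_mem : ∀ j, ξ j ∈ unitCircle
  zeros_inj : Function.Injective ξ
  mult_pos : ∀ j, 0 < m j
  factor : ∃ g : ℂ → ℂ, IsRationalOnDisk g ∧ (∀ ζ ∈ unitCircle, g ζ ≠ 0) ∧
    ∀ z ∈ Metric.closedBall (0:ℂ) 1, a z = a1fun ξ m z * g z

/-- The composition operator `C_φ` maps `H(b)` into itself and is bounded there
(with respect to the equivalent norm `⦀·⦀_b`). -/
def CompBddHb {n : ℕ} (ξ : Fin n → ℂ) (m : Fin n → ℕ) (φ : ℂ → ℂ) : Prop :=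
  (∀ f, MemHb ξ m f → MemHb ξ m fun z => f (φ z)) ∧
  ∃ C : ℝ, ∀ f, MemHb ξ m f →
    hbNormSq ξ m (fun z => f (φ z)) ≤ C * hbNormSq ξ m f

/-- The composition operator `C_φ` is compact on `H(b)`: it is bounded and the image of
every sequence in the unit ball has a subsequence whose image converges in `H(b)`. -/
def CompCompactHb {n : ℕ} (ξ : Fin n → ℂ) (m : Fin n → ℕ) (φ : ℂ → ℂ) : Prop :=
  CompBddHb ξ m φ ∧
  ∀ f : ℕ → ℂ → ℂ, (∀ k, MemHb ξ m (f k) ∧ hbNormSq ξ m (f k) ≤ 1) →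
    ∃ (κ : ℕ → ℕ) (g : ℂ → ℂ), StrictMono κ ∧ MemHb ξ m g ∧
      Tendsto (fun i => hbNormSq ξ m fun z => f (κ i) (φ z) - g z) atTop (nhds 0)

/-- The composition operator `C_φ` is Hilbert–Schmidt on `H(b)`: it is bounded and the sum
of `⦀C_φ e⦀²` over the orthonormal basis `{a₁ z^k}ₖ ∪ {z^j}_{j<N}` of
`(H(b), ⦀·⦀_b)` is finite (the finite part of the sum being automatically finite). -/
def CompHSHb {n : ℕ} (ξ : Fin n → ℂ) (m : Fin n → ℕ) (φ : ℂ → ℂ) : Prop :=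
  CompBddHb ξ m φ ∧
  Summable fun k : ℕ => hbNormSq ξ m fun z => a1fun ξ m (φ z) * φ z ^ k

/-- The weighted composition operator `W_{u,φ} f = u · (f ∘ φ)` maps `H²` boundedly
into itself. -/
def WCompBddH2 (u φ : ℂ → ℂ) : Prop :=
  (∀ f, MemH2 f → MemH2 fun z => u z * f (φ z)) ∧
  ∃ C : ℝ, ∀ f, MemH2 f →
    h2NormSq (fun z => u z * f (φ z)) ≤ C * h2NormSq f

/-- The weighted composition operator `W_{u,φ}` is compact on `H²`. -/
def WCompCompactH2 (u φ : ℂ → ℂ) : Prop :=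
  WCompBddH2 u φ ∧
  ∀ f : ℕ → ℂ → ℂ, (∀ k, MemH2 (f k) ∧ h2NormSq (f k) ≤ 1) →
    ∃ (κ : ℕ → ℕ) (g : ℂ → ℂ), StrictMono κ ∧ MemH2 g ∧
      Tendsto (fun i => h2NormSq fun z => u z * f (κ i) (φ z) - g z) atTop (nhds 0)

/-- The weighted composition operator `W_{u,φ}` is Hilbert–Schmidt on `H²`
(sum over the orthonormal basis `{z^k}` of `H²`). -/
def WCompHSH2 (u φ : ℂ → ℂ) : Prop :=
  WCompBddH2 u φ ∧ Summable fun k : ℕ => h2NormSq fun z => u z * φ z ^ k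

/-- The function `u = (a₁ ∘ φ) · ∏_{j ≥ p} (φ − φ(ξⱼ))^{mⱼ} / a₁`, where `Λ j = φ(ξ j)`
are the non-tangential limits of `φ` at the zeros of the mate. -/
def ufun {n : ℕ} (p : ℕ) (ξ : Fin n → ℂ) (m : Fin n → ℕ) (Λ : Fin n → ℂ)
    (φ : ℂ → ℂ) : ℂ → ℂ :=
  fun z => a1fun ξ m (φ z) *
    (∏ j ∈ Finset.univ.filter fun j : Fin n => p ≤ (j : ℕ), (φ z - Λ j) ^ (m j)) /
      a1fun ξ m z

/-- The reproducing kernel of the de Branges–Rovnyak space `H(c)`: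
`k_λ^c(z) = (1 − conj(c(λ)) c(z)) / (1 − conj(λ) z)`, as a function of the parameter `λ`
and the evaluation point `z`. -/
def rkKernel (c : ℂ → ℂ) (lam z : ℂ) : ℂ :=
  (1 - (starRingEnd ℂ) (c lam) * c z) / (1 - (starRingEnd ℂ) lam * z)

/-- `f` belongs to the reproducing kernel Hilbert space `H(c)` with squared norm at
most `t`: for all finite linear combinations of kernels,
`|⟨f, Σ αᵢ k_{λᵢ}⟩|² ≤ t · ‖Σ αᵢ k_{λᵢ}‖²`. -/
def HbRKBound (c f : ℂ → ℂ) (t : ℝ) : Prop :=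
  ∀ (k : ℕ) (lam α : Fin k → ℂ), (∀ i, lam i ∈ unitDisk) →
    ‖∑ i, (starRingEnd ℂ) (α i) * f (lam i)‖ ^ 2 ≤
      t * (∑ i, ∑ j, α i * (starRingEnd ℂ) (α j) * rkKernel c (lam i) (lam j)).re

/-- Membership in the de Branges–Rovnyak space `H(c)` (general RKHS definition). -/
def MemHbRK (c f : ℂ → ℂ) : Prop := ∃ t : ℝ, HbRKBound c f t

/-- `φ` has an angular derivative in the sense of Carathéodory at `ξ`:
`φ` and `φ'` have non-tangential limits at `ξ` and `|φ(ξ)| = 1`. -/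
def HasADC (φ : ℂ → ℂ) (ξ : ℂ) : Prop :=
  ∃ L L' : ℂ, ‖L‖ = 1 ∧ NTLimit φ ξ L ∧ NTLimit (deriv φ) ξ L'

/-- The measure `μ_{u,φ}(E) = ∫_{φ⁻¹(E) ∩ T} |u|² dm` (boundary values on the circle,
normalized Lebesgue measure). -/
def muMeas (u φ : ℂ → ℂ) (E : Set ℂ) : ENNReal :=
  (ENNReal.ofReal (2 * Real.pi))⁻¹ *
    ∫⁻ θ in Set.Ioc (0:ℝ) (2 * Real.pi),
      (if bdryVal φ (Complex.exp (θ * Complex.I)) ∈ E then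
        ENNReal.ofReal (‖bdryVal u (Complex.exp (θ * Complex.I))‖ ^ 2) else 0)

/-- `μ_{u,φ}` is a Carleson measure: `μ(S(ζ,r)) ≤ M r` for all Carleson windows
`S(ζ,r) = {z : |z| ≤ 1, |z − ζ| ≤ r}`, `ζ ∈ T`, `0 < r < 1`. -/
def IsCarleson (u φ : ℂ → ℂ) : Prop :=
  ∃ M : ℝ, 0 < M ∧ ∀ ζ ∈ unitCircle, ∀ r ∈ Set.Ioo (0:ℝ) 1,
    muMeas u φ (Metric.closedBall ζ r ∩ Metric.closedBall 0 1) ≤ ENNReal.ofReal (M * r)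

/-- `μ_{u,φ}` is a vanishing Carleson measure: `sup_{ζ∈T} μ(S(ζ,r))/r → 0` as `r → 0`. -/
def IsVanishingCarleson (u φ : ℂ → ℂ) : Prop :=
  ∀ ε > (0:ℝ), ∃ r₀ ∈ Set.Ioo (0:ℝ) 1, ∀ r ∈ Set.Ioo (0:ℝ) r₀, ∀ ζ ∈ unitCircle,
    muMeas u φ (Metric.closedBall ζ r ∩ Metric.closedBall 0 1) ≤ ENNReal.ofReal (ε * r)

/-- The reproducing kernel integral
`∫_T (1 − |w|²) |u(ξ)|² / |1 − conj(w) φ(ξ)|² dm(ξ)`. -/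
def repKerInt (u φ : ℂ → ℂ) (w : ℂ) : ENNReal :=
  (ENNReal.ofReal (2 * Real.pi))⁻¹ *
    ∫⁻ θ in Set.Ioc (0:ℝ) (2 * Real.pi),
      ENNReal.ofReal ((1 - ‖w‖ ^ 2) * ‖bdryVal u (Complex.exp (θ * Complex.I))‖ ^ 2 /
        ‖1 - (starRingEnd ℂ) w * bdryVal φ (Complex.exp (θ * Complex.I))‖ ^ 2)

/-- Membership in the model space `K_I = H² ⊖ I H²`. -/
def MemKI (I f : ℂ → ℂ) : Prop :=
  MemH2 f ∧ ∀ g, MemH2 g → h2Inner (fun z => I z * g z) f = 0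

/-- A set of functions is closed in `H(b)` (with respect to the equivalent norm). -/
def HbClosedSet {n : ℕ} (ξ : Fin n → ℂ) (m : Fin n → ℕ) (S : Set (ℂ → ℂ)) : Prop :=
  ∀ f, MemHb ξ m f →
    (∀ ε > (0:ℝ), ∃ g ∈ S, hbNormSq ξ m (fun z => f z - g z) < ε) → f ∈ S

lemma cauchy_deriv_bdry {G : ℂ → ℂ} (hG : DiffContOnCl ℂ G (Metric.ball 0 1)) {w : ℂ}
    (hw : w ∈ Metric.ball (0:ℂ) 1) :
    (∮ z in C(0, 1), ((z - w) ^ 2)⁻¹ * G z) = (2 * Real.pi * Complex.I : ℂ) * deriv G w := by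
  have hd : DiffContOnCl ℂ (dslope G w) (Metric.ball 0 1) := by
    refine ⟨(differentiableOn_dslope (Metric.isOpen_ball.mem_nhds hw)).2 hG.differentiableOn, ?_⟩
    rw [closure_ball _ one_ne_zero]
    refine (continuousOn_dslope (mem_of_superset (Metric.isOpen_ball.mem_nhds hw)
      Metric.ball_subset_closedBall)).2 ⟨?_, hG.differentiableAt Metric.isOpen_ball hw⟩
    have := hG.continuousOn
    rwa [closure_ball _ one_ne_zero] at this
  have h1 := hd.circleIntegral_sub_inv_smul hw
  rw [dslope_same] at h1
  have hne : ∀ z ∈ Metric.sphere (0:ℂ) 1, z - w ≠ 0 := by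
    intro z hz h
    rw [sub_eq_zero] at h
    subst h
    simp at hz hw
    linarith
  have hGc : ContinuousOn G (Metric.sphere 0 1) := by
    have := hG.continuousOn
    rw [closure_ball _ one_ne_zero] at this
    exact this.mono Metric.sphere_subset_closedBall
  have hi : ContinuousOn (fun z => ((z - w) ^ 2)⁻¹) (Metric.sphere (0:ℂ) 1) :=
    ContinuousOn.inv₀ (by fun_prop) fun z hz => pow_ne_zero _ (hne z hz)
  have h2 : (∮ z in C(0, 1), (z - w)⁻¹ • dslope G w z) =
      ∮ z in C(0, 1), (((z - w) ^ 2)⁻¹ * G z - G w * ((z - w) ^ 2)⁻¹) := by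
    refine circleIntegral.integral_congr zero_le_one fun z hz => ?_
    have := hne z hz
    rw [dslope_of_ne _ (sub_ne_zero.1 this), slope_def_field]
    simp only [smul_eq_mul]
    field_simp
  rw [h2, circleIntegral.integral_sub] at h1
  · have h3 : (∮ z in C(0, 1), G w * ((z - w) ^ 2)⁻¹) = 0 := by
      rw [circleIntegral.integral_const_mul]
      have := circleIntegral.integral_sub_zpow_of_ne (n := -2) (by norm_num) 0 w 1
      have e : (fun z : ℂ => ((z - w) ^ 2)⁻¹) = fun z => (z - w) ^ (-2 : ℤ) := by
        ext z; rw [zpow_neg]; norm_cast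
      rw [e, this, mul_zero]
    rw [h3, sub_zero] at h1
    simpa using h1
  · exact ContinuousOn.circleIntegrable zero_le_one (hi.mul hGc)
  · exact ContinuousOn.circleIntegrable zero_le_one (continuousOn_const.mul hi)

lemma poisson_int {w : ℂ} (hw : w ∈ Metric.ball (0:ℂ) 1) :
    ∫ θ in (0:ℝ)..2 * Real.pi, (1 - ‖w‖ ^ 2) / ‖circleMap 0 1 θ - w‖ ^ 2 = 2 * Real.pi := by
  have h := DiffContOnCl.circleAverage_poissonKernel_smul' (c := 0) (R := 1)
    (f := fun _ : ℂ => (1:ℂ)) diffContOnCl_const hw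
  rw [Real.circleAverage_def] at h
  have hpi := Real.pi_pos
  have e : ∀ θ : ℝ, ((‖circleMap 0 1 θ - 0‖ ^ 2 - ‖w - 0‖ ^ 2) / ‖(circleMap 0 1 θ - 0) - (w - 0)‖ ^ 2) • (1:ℂ)
      = (((1 - ‖w‖ ^ 2) / ‖circleMap 0 1 θ - w‖ ^ 2 : ℝ) : ℂ) := by
    intro θ; simp
  simp only [e] at h
  rw [intervalIntegral.integral_ofReal, Complex.real_smul] at h
  have h' : (2 * Real.pi)⁻¹ * ∫ θ in (0:ℝ)..2 * Real.pi, (1 - ‖w‖ ^ 2) / ‖circleMap 0 1 θ - w‖ ^ 2 = 1 := by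
    exact_mod_cast h
  field_simp at h'
  linarith

/-- the key kernel estimate -/
lemma deriv_bound {G : ℂ → ℂ} (hG : DiffContOnCl ℂ G (Metric.ball 0 1)) {ζ₀ : ℂ} (h0 : ‖ζ₀‖ = 1)
    {ε K : ℝ} (hε : 0 ≤ ε) (hK : 0 ≤ K)
    (hb : ∀ ζ : ℂ, ‖ζ‖ = 1 → ‖G ζ‖ ≤ ε * ‖ζ - ζ₀‖ + K * ‖ζ - ζ₀‖ ^ 3)
    {r : ℝ} (hr0 : 0 ≤ r) (hr1 : r < 1) :
    ‖deriv G (r * ζ₀)‖ ≤ 16 * ε + 64 * K * (1 - r) := by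
  set w : ℂ := r * ζ₀ with hwdef
  set v : ℂ := (2 - r) * ζ₀ with hvdef
  have hwn : ‖w‖ = r := by simp [hwdef, h0, abs_of_nonneg hr0]
  have hw : w ∈ Metric.ball (0:ℂ) 1 := by simpa [hwn]
  have hvn : ‖v‖ = 2 - r := by
    rw [hvdef, norm_mul, h0, mul_one]
    have : ((2:ℂ) - r) = ((2 - r : ℝ) : ℂ) := by push_cast; rfl
    rw [this, Complex.norm_real, Real.norm_eq_abs, abs_of_nonneg]; linarith
  have hnv : ∀ z : ℂ, ‖z‖ ≤ 1 → z - v ≠ 0 := by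
    intro z hz h
    rw [sub_eq_zero] at h
    rw [h, hvn] at hz; linarith
  have hnw : ∀ z : ℂ, ‖z‖ = 1 → z - w ≠ 0 := by
    intro z hz h
    rw [sub_eq_zero] at h
    rw [h, hwn] at hz; linarith
  have hGcl : ContinuousOn G (Metric.closedBall 0 1) := by
    have := hG.continuousOn
    rwa [closure_ball _ one_ne_zero] at this
  have hGc : ContinuousOn G (Metric.sphere 0 1) := hGcl.mono Metric.sphere_subset_closedBall
  have c1 : CircleIntegrable (fun z => ((z - w) ^ 2)⁻¹ * G z) 0 1 :=
    ContinuousOn.circleIntegrable zero_le_one (ContinuousOn.mul (ContinuousOn.inv₀ (by fun_prop)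
      fun z hz => pow_ne_zero _ (hnw z (by simpa using hz))) hGc)
  have c2 : CircleIntegrable (fun z => ((z - v) ^ 2)⁻¹ * G z) 0 1 :=
    ContinuousOn.circleIntegrable zero_le_one (ContinuousOn.mul (ContinuousOn.inv₀ (by fun_prop)
      fun z hz => pow_ne_zero _ (hnv z (by simpa using hz.le))) hGc)
  have i1 := cauchy_deriv_bdry hG hw
  have i2 : (∮ z in C(0, 1), ((z - v) ^ 2)⁻¹ * G z) = 0 := by
    refine DiffContOnCl.circleIntegral_eq_zero zero_le_one ⟨?_, ?_⟩
    · refine DifferentiableOn.mul (DifferentiableOn.inv (by fun_prop) fun z hz =>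
        pow_ne_zero _ (hnv z ?_)) hG.differentiableOn
      simp at hz; exact hz.le
    · rw [closure_ball _ one_ne_zero]
      refine ContinuousOn.mul (ContinuousOn.inv₀ (by fun_prop) fun z hz =>
        pow_ne_zero _ (hnv z ?_)) hGcl
      simpa using hz
  have i3 : (2 * Real.pi * Complex.I : ℂ) * deriv G w =
      ∮ z in C(0, 1), (((z - w) ^ 2)⁻¹ * G z - ((z - v) ^ 2)⁻¹ * G z) := by
    rw [circleIntegral.integral_sub c1 c2, i1, i2, sub_zero]
  have hpt : ∀ z : ℂ, ‖z‖ = 1 → ‖((z - w) ^ 2)⁻¹ * G z - ((z - v) ^ 2)⁻¹ * G z‖ ≤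
      16 * ε * ((1 - ‖w‖ ^ 2) / ‖z - w‖ ^ 2) + 64 * K * (1 - r) := by
    intro z hz
    have hzw := hnw z hz
    have hzv := hnv z hz.le
    have e1 : ((z - w) ^ 2)⁻¹ * G z - ((z - v) ^ 2)⁻¹ * G z
        = -(4 * (1 - r) * ζ₀ * (z - ζ₀)) / ((z - w) ^ 2 * (z - v) ^ 2) * G z := by
      field_simp
      rw [hwdef, hvdef]; ring
    have hA : 0 < ‖z - w‖ := norm_pos_iff.2 hzw
    have n1 : ‖(1:ℂ) - r‖ = 1 - r := by
      have : ((1:ℂ) - r) = ((1 - r : ℝ) : ℂ) := by push_cast; rfl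
      rw [this, Complex.norm_real, Real.norm_eq_abs, abs_of_nonneg]; linarith
    have hAr : 1 - r ≤ ‖z - w‖ := by
      have := norm_sub_norm_le z w
      rw [hz, hwn] at this; exact this
    have hd : ‖z - ζ₀‖ ≤ 2 * ‖z - w‖ := by
      have : z - ζ₀ = (z - w) - (1 - r) * ζ₀ := by rw [hwdef]; ring
      rw [this]
      refine (norm_sub_le _ _).trans ?_
      rw [norm_mul, n1, h0]; linarith
    have hB : ‖z - w‖ ≤ ‖z - v‖ := by
      refine abs_le_of_sq_le_sq' ?_ (norm_nonneg _) |>.2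
      rw [← Complex.normSq_eq_norm_sq, ← Complex.normSq_eq_norm_sq]
      have hz' : z.re * z.re + z.im * z.im = 1 := by
        rw [← Complex.normSq_apply, Complex.normSq_eq_norm_sq, hz]; norm_num
      have h0' : ζ₀.re * ζ₀.re + ζ₀.im * ζ₀.im = 1 := by
        rw [← Complex.normSq_apply, Complex.normSq_eq_norm_sq, h0]; norm_num
      simp [hwdef, hvdef, Complex.normSq_apply]
      nlinarith [sq_nonneg (z.re - ζ₀.re), sq_nonneg (z.im - ζ₀.im),
        mul_nonneg (sub_nonneg.2 hr1.le) (add_nonneg (sq_nonneg (z.re - ζ₀.re)) (sq_nonneg (z.im - ζ₀.im)))]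
    set A := ‖z - w‖
    set B := ‖z - v‖
    set d := ‖z - ζ₀‖
    have hd0 : 0 ≤ d := norm_nonneg _
    rw [e1, norm_mul, norm_div, norm_neg, norm_mul, norm_mul, norm_mul, norm_mul, n1, h0, norm_pow, norm_pow]
    have hb' := hb z hz
    have : ‖(4:ℂ)‖ = 4 := by simp
    rw [this, hwn, mul_one]
    change 4 * (1 - r) * d / (A ^ 2 * B ^ 2) * ‖G z‖ ≤ _
    have s1 : 4 * (1 - r) * d / (A ^ 2 * B ^ 2) ≤ 4 * (1 - r) * d / (A ^ 2 * A ^ 2) := by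
      have : 0 ≤ 4 * (1 - r) * d := by
        have : 0 ≤ 1 - r := by linarith
        positivity
      gcongr
    have hr' : 0 ≤ 1 - r := by linarith
    calc 4 * (1 - r) * d / (A ^ 2 * B ^ 2) * ‖G z‖
        ≤ 4 * (1 - r) * d / (A ^ 2 * A ^ 2) * (ε * d + K * d ^ 3) := by gcongr
      _ = 4 * (1 - r) * ε * d ^ 2 / A ^ 4 + 4 * (1 - r) * K * d ^ 4 / A ^ 4 := by
          field_simp
      _ ≤ 4 * (1 - r) * ε * (2 * A) ^ 2 / A ^ 4 + 4 * (1 - r) * K * (2 * A) ^ 4 / A ^ 4 := by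
          gcongr
      _ = 16 * ε * ((1 - r) / A ^ 2) + 64 * K * (1 - r) := by
          field_simp; ring
      _ ≤ 16 * ε * ((1 - r ^ 2) / A ^ 2) + 64 * K * (1 - r) := by
          gcongr
          nlinarith
  have hbd : ‖(2 * Real.pi * Complex.I : ℂ) * deriv G w‖ ≤
      ∫ θ in (0:ℝ)..2 * Real.pi, (16 * ε * ((1 - ‖w‖ ^ 2) / ‖circleMap 0 1 θ - w‖ ^ 2) + 64 * K * (1 - r)) := by
    rw [i3, circleIntegral]
    refine intervalIntegral.norm_integral_le_of_norm_le Real.two_pi_pos.le ?_ ?_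
    · refine Eventually.of_forall fun θ _ => ?_
      have := hpt (circleMap 0 1 θ) (by simp)
      simpa [norm_smul] using this
    · refine Continuous.intervalIntegrable ?_ _ _
      refine Continuous.add (Continuous.mul continuous_const (Continuous.div continuous_const ?_ ?_)) continuous_const
      · fun_prop
      · intro θ
        have := hnw (circleMap 0 1 θ) (by simp)
        exact pow_ne_zero _ (norm_ne_zero_iff.2 this)
  have hci : IntervalIntegrable (fun θ => 16 * ε * ((1 - ‖w‖ ^ 2) / ‖circleMap 0 1 θ - w‖ ^ 2)) volume 0 (2 * Real.pi) := by
    refine Continuous.intervalIntegrable ?_ _ _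
    refine (Continuous.mul continuous_const (Continuous.div continuous_const ?_ ?_))
    · fun_prop
    · intro θ
      have := hnw (circleMap 0 1 θ) (by simp)
      exact pow_ne_zero _ (norm_ne_zero_iff.2 this)
  rw [intervalIntegral.integral_add hci (by simp), intervalIntegral.integral_const_mul, poisson_int hw,
    intervalIntegral.integral_const, norm_mul] at hbd
  have hpi := Real.pi_pos
  have : ‖(2 * Real.pi * Complex.I : ℂ)‖ = 2 * Real.pi := by simp [abs_of_pos hpi]
  rw [this, smul_eq_mul] at hbd
  have : 2 * Real.pi * ‖deriv G w‖ ≤ 2 * Real.pi * (16 * ε + 64 * K * (1 - r)) := by linarith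
  exact le_of_mul_le_mul_left this (by positivity)

lemma fatou_point {g : ℂ → ℂ} (hg : DiffContOnCl ℂ g (Metric.ball 0 1)) {θ₀ : ℝ}
    (hd : DifferentiableAt ℝ (fun θ : ℝ => g (Complex.exp (θ * Complex.I))) θ₀) :
    ∃ L, Tendsto (fun r : ℝ => deriv g (r * Complex.exp (θ₀ * Complex.I))) (nhdsWithin 1 (Iio 1)) (nhds L) := by
  set ζ₀ : ℂ := Complex.exp (θ₀ * Complex.I) with hζ
  have h0 : ‖ζ₀‖ = 1 := Complex.norm_exp_ofReal_mul_I θ₀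
  have hζne : ζ₀ ≠ 0 := Complex.exp_ne_zero _
  obtain ⟨D, hD⟩ : ∃ D, HasDerivAt (fun θ : ℝ => g (Complex.exp (θ * Complex.I))) D θ₀ := ⟨_, hd.hasDerivAt⟩
  set c : ℂ := D / (ζ₀ * Complex.I) with hc
  set G : ℂ → ℂ := fun z => g z - g ζ₀ - c * (z - ζ₀) with hGdef
  have hG : DiffContOnCl ℂ G (Metric.ball 0 1) := by
    refine (hg.sub diffContOnCl_const).sub ?_
    exact Differentiable.diffContOnCl (by fun_prop)
  -- derivative of G along circle vanishes
  have hE : HasDerivAt (fun θ : ℝ => Complex.exp (θ * Complex.I)) (ζ₀ * Complex.I) θ₀ := by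
    have := ((Complex.ofRealCLM.hasDerivAt (x := θ₀)).mul_const Complex.I).cexp
    simpa using this
  have hG' : HasDerivAt (fun θ : ℝ => G (Complex.exp (θ * Complex.I))) 0 θ₀ := by
    have := (hD.sub_const (g ζ₀)).sub ((hE.sub_const ζ₀).const_mul c)
    have e0 : D - c * (ζ₀ * Complex.I) = 0 := by
      rw [hc, div_mul_cancel₀, sub_self]
      exact mul_ne_zero hζne Complex.I_ne_zero
    rw [e0] at this
    exact this
  have hlo : (fun θ : ℝ => G (Complex.exp (θ * Complex.I))) =o[nhds θ₀] fun θ => θ - θ₀ := by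
    have := hasDerivAt_iff_isLittleO.1 hG'
    have e0 : G (Complex.exp (θ₀ * Complex.I)) = 0 := by simp [hGdef, ← hζ]
    simpa only [e0, sub_zero, smul_zero] using this
  -- angle function
  set φ : ℂ → ℝ := fun ζ => θ₀ + (Complex.log (ζ / ζ₀)).im with hφ
  have hlog : HasDerivAt (fun ζ => Complex.log (ζ / ζ₀)) (1 / ζ₀ / (ζ₀ / ζ₀)) ζ₀ := by
    refine HasDerivAt.clog ((hasDerivAt_id ζ₀).div_const ζ₀) ?_
    simp [hζne]
  have hφ0 : φ ζ₀ = θ₀ := by simp [hφ, hζne]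
  have hφO : (fun ζ => φ ζ - θ₀) =O[nhds ζ₀] fun ζ => ζ - ζ₀ := by
    have h1 := hlog.isBigO_sub
    refine Asymptotics.IsBigO.trans ?_ h1
    refine Asymptotics.IsBigO.of_bound 1 (Eventually.of_forall fun ζ => ?_)
    simp [hφ, hζne]
    exact Complex.abs_im_le_norm _
  have hφc : Tendsto φ (nhds ζ₀) (nhds θ₀) := by
    have := (Complex.continuous_im.tendsto _).comp hlog.continuousAt
    have := this.const_add θ₀
    simpa [hφ, hζne] using this
  have hφe : ∀ ζ : ℂ, ‖ζ‖ = 1 → Complex.exp (φ ζ * Complex.I) = ζ := by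
    intro ζ hz
    have hz0 : ζ ≠ 0 := by intro h; simp [h] at hz
    have hq : ‖ζ / ζ₀‖ = 1 := by rw [norm_div, hz, h0, div_one]
    have : Complex.log (ζ / ζ₀) = ((Complex.log (ζ / ζ₀)).im : ℂ) * Complex.I := by
      apply Complex.ext <;> simp [Complex.log_re, hz, h0]
    have e2 : (φ ζ : ℂ) * Complex.I = θ₀ * Complex.I + Complex.log (ζ / ζ₀) := by
      rw [this]; simp only [hφ]; push_cast; ring_nf
    rw [e2, Complex.exp_add, Complex.exp_log (div_ne_zero hz0 hζne), ← hζ]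
    field_simp
  have hlo2 : (fun ζ => G (Complex.exp (φ ζ * Complex.I))) =o[nhds ζ₀] fun ζ => ζ - ζ₀ :=
    (hlo.comp_tendsto hφc).trans_isBigO hφO
  -- bound of G on the circle
  have hGcl : ContinuousOn G (Metric.closedBall 0 1) := by
    have := hG.continuousOn
    rwa [closure_ball _ one_ne_zero] at this
  obtain ⟨M, hM⟩ := (isCompact_closedBall (0:ℂ) 1).exists_bound_of_continuousOn hGcl
  have hM0 : 0 ≤ M := (norm_nonneg _).trans (hM 0 (by simp))
  have hGder : Tendsto (fun r : ℝ => deriv G (r * ζ₀)) (nhdsWithin 1 (Iio 1)) (nhds 0) := by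
    rw [Metric.tendsto_nhds]
    intro η hη
    have hb := (hlo2.bound (show (0:ℝ) < η / 64 by positivity))
    obtain ⟨δ, hδ, hδb⟩ := Metric.eventually_nhds_iff.1 hb
    have key : ∀ ζ : ℂ, ‖ζ‖ = 1 → ‖G ζ‖ ≤ (η / 64) * ‖ζ - ζ₀‖ + (M / δ ^ 3) * ‖ζ - ζ₀‖ ^ 3 := by
      intro ζ hz
      by_cases h : dist ζ ζ₀ < δ
      · have := hδb h
        rw [hφe ζ hz] at this
        have h2 : 0 ≤ (M / δ ^ 3) * ‖ζ - ζ₀‖ ^ 3 := by positivity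
        linarith
      · rw [not_lt, dist_eq_norm] at h
        have h1 : ‖G ζ‖ ≤ M := hM ζ (by simp [hz])
        have h2 : M ≤ (M / δ ^ 3) * ‖ζ - ζ₀‖ ^ 3 := by
          rw [div_mul_eq_mul_div, le_div_iff₀ (by positivity)]
          gcongr
        have h3 : 0 ≤ (η / 64) * ‖ζ - ζ₀‖ := by positivity
        linarith
    have lim2 : Tendsto (fun r : ℝ => 16 * (η / 64) + 64 * (M / δ ^ 3) * (1 - r)) (nhdsWithin 1 (Iio 1))
        (nhds (16 * (η / 64) + 64 * (M / δ ^ 3) * (1 - 1))) := by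
      refine Tendsto.mono_left (Continuous.tendsto ?_ 1) nhdsWithin_le_nhds
      fun_prop
    have e1 := lim2.eventually (gt_mem_nhds (show 16 * (η / 64) + 64 * (M / δ ^ 3) * (1 - 1) < η by
      rw [sub_self, mul_zero]; linarith))
    have e2 : ∀ᶠ r : ℝ in nhdsWithin 1 (Iio 1), 0 ≤ r :=
      (Filter.Eventually.filter_mono nhdsWithin_le_nhds
        ((lt_mem_nhds (show (0:ℝ) < 1 by norm_num)).mono fun _ h => h.le))
    filter_upwards [e1, e2, self_mem_nhdsWithin] with r h1 h2 h3
    rw [dist_zero_right]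
    exact (deriv_bound hG h0 (by positivity) (by positivity) key h2 h3).trans_lt h1
  refine ⟨c, ?_⟩
  have := hGder.add_const c
  rw [zero_add] at this
  refine this.congr' ?_
  have e2 : ∀ᶠ r : ℝ in nhdsWithin 1 (Iio 1), 0 < r :=
      (Filter.Eventually.filter_mono nhdsWithin_le_nhds
        ((lt_mem_nhds (show (0:ℝ) < 1 by norm_num))))
  filter_upwards [e2, self_mem_nhdsWithin] with r h2 h3
  have hw : (r * ζ₀ : ℂ) ∈ Metric.ball (0:ℂ) 1 := by
    simp [h0, abs_of_pos h2]; exact h3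
  have hgd := (hg.differentiableAt Metric.isOpen_ball hw).hasDerivAt
  have : HasDerivAt G (deriv g (r * ζ₀) - c) (r * ζ₀) := by
    have := (hgd.sub_const (g ζ₀)).sub (((hasDerivAt_id (r * ζ₀ : ℂ)).sub_const ζ₀).const_mul c)
    rw [mul_one] at this
    exact this
  rw [this.deriv]; ring

theorem fatou {f : ℂ → ℂ} (hf : DifferentiableOn ℂ f unitDisk) {C : ℝ}
    (hC : ∀ z ∈ unitDisk, ‖f z‖ ≤ C) :
    ∀ᵐ θ : ℝ, ∃ L, Tendsto (fun r : ℝ => f (r * Complex.exp (θ * Complex.I)))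
      (nhdsWithin 1 (Iio 1)) (nhds L) := by
  obtain ⟨F, hF⟩ := DifferentiableOn.isExactOn_ball hf
  have hC0 : 0 ≤ C := (norm_nonneg _).trans (hC 0 (by simp [unitDisk]))
  have hl : LipschitzOnWith ⟨C, hC0⟩ F (Metric.ball 0 1) := by
    refine Convex.lipschitzOnWith_of_nnnorm_hasDerivWithin_le (convex_ball 0 1)
      (fun x hx => (hF x hx).hasDerivWithinAt) fun x hx => ?_
    exact hC x hx
  obtain ⟨g, hgl, hgF⟩ := hl.extend_finite_dimension
  have hgd : ∀ z ∈ Metric.ball (0:ℂ) 1, HasDerivAt g (f z) z := fun z hz =>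
    (hF z hz).congr_of_eventuallyEq
      (by filter_upwards [Metric.isOpen_ball.mem_nhds hz] with y hy using (hgF hy).symm)
  have hg : DiffContOnCl ℂ g (Metric.ball 0 1) :=
    ⟨fun z hz => (hgd z hz).differentiableAt.differentiableWithinAt, hgl.continuous.continuousOn⟩
  have hcl : LipschitzWith 1 (fun θ : ℝ => Complex.exp (θ * Complex.I)) := by
    have := lipschitzWith_circleMap 0 1
    have e : (fun θ : ℝ => Complex.exp (θ * Complex.I)) = circleMap 0 1 := by
      ext θ; simp [circleMap]
    rw [e]; simpa using this
  filter_upwards [(hgl.comp hcl).ae_differentiableAt_real] with θ hθ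
  obtain ⟨L, hL⟩ := fatou_point hg hθ
  refine ⟨L, hL.congr' ?_⟩
  have e2 : ∀ᶠ r : ℝ in nhdsWithin 1 (Iio 1), 0 < r :=
      (Filter.Eventually.filter_mono nhdsWithin_le_nhds
        ((lt_mem_nhds (show (0:ℝ) < 1 by norm_num))))
  filter_upwards [e2, self_mem_nhdsWithin] with r h2 h3
  refine (hgd _ ?_).deriv
  simp [Complex.norm_exp_ofReal_mul_I, abs_of_pos h2]; exact h3

lemma inner_radial {f : ℂ → ℂ} (hf : MemBallHinf f)
    (hIinner : ∀ᵐ (θ : ℝ) ∂(volume.restrict (Set.Ioc (0:ℝ) (2 * Real.pi))),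
      ‖bdryVal f (Complex.exp (θ * Complex.I))‖ = 1) :
    ∀ᵐ (θ : ℝ) ∂(volume.restrict (Set.Ioc (0:ℝ) (2 * Real.pi))),
      Tendsto (fun r : ℝ => ‖f (circleMap 0 r θ)‖) (nhdsWithin 1 (Iio 1)) (nhds 1) := by
  filter_upwards [hIinner, ae_restrict_of_ae (fatou hf.1 hf.2)] with θ h1 ⟨L, hL⟩
  have : bdryVal f (Complex.exp (θ * Complex.I)) = L := hL.limUnder_eq
  rw [this] at h1
  have h2 := hL.norm
  rw [h1] at h2
  simpa [circleMap] using h2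

lemma isOpen_unitDisk : IsOpen unitDisk := Metric.isOpen_ball
lemma zero_mem_unitDisk : (0:ℂ) ∈ unitDisk := by simp [unitDisk]
lemma mem_unitDisk {z : ℂ} : z ∈ unitDisk ↔ ‖z‖ < 1 := by simp [unitDisk]

lemma taylor_hasSum {f : ℂ → ℂ} (hf : DifferentiableOn ℂ f unitDisk) {z : ℂ} (hz : z ∈ unitDisk) :
    HasSum (fun k => taylorCoeff f k * z ^ k) (f z) := by
  have := Complex.hasSum_taylorSeries_on_ball hf hz
  refine this.congr_fun ?_ |> id
  intro k
  simp [taylorCoeff]; ring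

lemma taylor_congr {f g : ℂ → ℂ} (h : ∀ z ∈ unitDisk, f z = g z) (k : ℕ) :
    taylorCoeff f k = taylorCoeff g k := by
  unfold taylorCoeff
  rw [Filter.EventuallyEq.iteratedDeriv_eq]
  filter_upwards [isOpen_unitDisk.mem_nhds zero_mem_unitDisk] with z hz using h z hz

/-- functions given by a power series on the disk -/
lemma taylor_of_hasSum {f : ℂ → ℂ} {c : ℕ → ℂ}
    (h : ∀ z ∈ unitDisk, HasSum (fun k => c k * z ^ k) (f z)) :
    DifferentiableOn ℂ f unitDisk ∧ ∀ k, taylorCoeff f k = c k := by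
  have hp : HasFPowerSeriesOnBall f (FormalMultilinearSeries.ofScalars ℂ c) 0 1 := by
    refine ⟨?_, one_pos, ?_⟩
    · refine ENNReal.le_of_forall_nnreal_lt fun r hr => ?_
      have hr1 : (r:ℝ) < 1 := by exact_mod_cast hr
      refine FormalMultilinearSeries.le_radius_of_tendsto (l := 0) _ ?_
      have := (h (r:ℂ) (by simp [mem_unitDisk]; exact_mod_cast hr)).summable.tendsto_atTop_zero.norm
      rw [norm_zero] at this
      refine this.congr fun k => ?_
      simp [FormalMultilinearSeries.ofScalars_norm]
    · intro y hy
      have hy' : y ∈ unitDisk := by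
        rw [mem_unitDisk]
        rw [← ENNReal.coe_one, Metric.eball_coe] at hy
        simpa using hy
      have := h y hy'
      rw [zero_add]
      refine this.congr_fun ?_ |> id
      intro k
      simp [FormalMultilinearSeries.ofScalars_apply_eq, mul_comm]
  have hd : DifferentiableOn ℂ f unitDisk := by
    have := hp.differentiableOn
    refine this.mono fun z hz => ?_
    rw [mem_unitDisk] at hz
    rw [← ENNReal.coe_one, Metric.eball_coe]
    simpa using hz
  refine ⟨hd, fun k => ?_⟩
  have h1 := hp.hasFPowerSeriesAt.eq_formalMultilinearSeries
    (hp.analyticAt.hasFPowerSeriesAt)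
  have h2 := congrArg (fun p : FormalMultilinearSeries ℂ ℂ ℂ => p.coeff k) h1
  simp [FormalMultilinearSeries.coeff_ofScalars] at h2
  rw [taylorCoeff, h2]

def mean (f : ℂ → ℂ) (r : ℝ) : ℝ :=
  (2 * Real.pi)⁻¹ * ∫ θ in (0:ℝ)..2 * Real.pi, ‖f (circleMap 0 r θ)‖ ^ 2

lemma circleMap_mem {r : ℝ} (h0 : 0 ≤ r) (h1 : r < 1) (θ : ℝ) : circleMap 0 r θ ∈ unitDisk := by
  simpa [mem_unitDisk, abs_of_nonneg h0]

lemma cont_circle {f : ℂ → ℂ} (hf : DifferentiableOn ℂ f unitDisk) {r : ℝ} (h0 : 0 ≤ r) (h1 : r < 1) :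
    Continuous fun θ => f (circleMap 0 r θ) :=
  hf.continuousOn.comp_continuous (continuous_circleMap 0 r) (circleMap_mem h0 h1)

lemma parseval {f : ℂ → ℂ} (hf : DifferentiableOn ℂ f unitDisk) {r : ℝ} (h0 : 0 ≤ r) (h1 : r < 1) :
    HasSum (fun k => ‖taylorCoeff f k‖ ^ 2 * (r ^ 2) ^ k) (mean f r) := by
  have hnn : ∀ k, 0 ≤ ‖taylorCoeff f k‖ ^ 2 * (r ^ 2) ^ k := fun k => by positivity
  rw [hasSum_iff_tendsto_nat_of_nonneg hnn]
  set P : ℕ → Polynomial ℂ := fun K => ∑ k ∈ Finset.range K, Polynomial.C (taylorCoeff f k * r ^ k) * Polynomial.X ^ k with hP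
  have hcoef : ∀ K i, (P K).coeff i = if i < K then taylorCoeff f i * r ^ i else 0 := by
    intro K i
    simp only [hP, Polynomial.finsetSum_coeff, Polynomial.coeff_C_mul_X_pow]
    by_cases h : i < K
    · simp [h]
    · simp [h]
  have e1 : ∀ K, ∑ k ∈ Finset.range K, ‖taylorCoeff f k‖ ^ 2 * (r ^ 2) ^ k =
      (2 * Real.pi)⁻¹ * ∫ θ in (0:ℝ)..2 * Real.pi, ‖(P K).eval (circleMap 0 1 θ)‖ ^ 2 := by
    intro K
    have := Polynomial.sum_sq_norm_coeff_eq_circleAverage (P K)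
    rw [Real.circleAverage_def, smul_eq_mul] at this
    rw [← this]
    symm
    rw [Finset.sum_subset (s₂ := Finset.range K)]
    · refine Finset.sum_congr rfl fun k hk => ?_
      rw [hcoef, if_pos (Finset.mem_range.1 hk), norm_mul, norm_pow, Complex.norm_real, Real.norm_eq_abs,
        abs_of_nonneg h0]
      ring
    · intro i hi
      rw [Polynomial.mem_support_iff, hcoef] at hi
      by_contra h
      rw [Finset.mem_range] at h
      simp [h] at hi
    · intro i _ hi
      rw [Polynomial.mem_support_iff, not_not] at hi
      simp [hi]
  simp only [e1]
  have hsum : Summable fun k => ‖taylorCoeff f k * (r:ℂ) ^ k‖ :=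
    (taylor_hasSum hf (z := (r:ℂ)) (by simpa [mem_unitDisk, abs_of_nonneg h0])).summable.norm
  have hev : ∀ K θ, (P K).eval (circleMap 0 1 θ) = ∑ k ∈ Finset.range K, taylorCoeff f k * (circleMap 0 r θ) ^ k := by
    intro K θ
    simp only [hP, Polynomial.eval_finsetSum]
    refine Finset.sum_congr rfl fun k _ => ?_
    simp [circleMap]; ring
  refine Tendsto.const_mul _ ?_
  refine intervalIntegral.tendsto_integral_filter_of_dominated_convergence
    (fun _ => (∑' k, ‖taylorCoeff f k * (r:ℂ) ^ k‖) ^ 2) ?_ ?_ ?_ ?_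
  · refine Eventually.of_forall fun K => Continuous.aestronglyMeasurable ?_
    have : Continuous fun θ => (P K).eval (circleMap 0 1 θ) :=
      (Polynomial.continuous _).comp (continuous_circleMap 0 1)
    exact this.norm.pow 2
  · refine Eventually.of_forall fun K => Eventually.of_forall fun θ _ => ?_
    rw [norm_pow, norm_norm, hev]
    gcongr
    refine (norm_sum_le _ _).trans ?_
    refine le_trans (le_of_eq ?_) (hsum.sum_le_tsum (Finset.range K) fun k _ => norm_nonneg _)
    refine Finset.sum_congr rfl fun k _ => ?_
    simp
  · simp
  · refine Eventually.of_forall fun θ _ => ?_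
    simp only [hev]
    exact ((taylor_hasSum hf (circleMap_mem h0 h1 θ)).tendsto_sum_nat.norm).pow 2

lemma mean_mono_congr {f g : ℂ → ℂ} (hf : DifferentiableOn ℂ f unitDisk) (hg : DifferentiableOn ℂ g unitDisk)
    {r : ℝ} (h0 : 0 ≤ r) (h1 : r < 1) {A : ℝ} (h : ∀ z, ‖z‖ = r → ‖f z‖ ^ 2 ≤ A * ‖g z‖ ^ 2) :
    mean f r ≤ A * mean g r := by
  unfold mean
  have h2 : ∫ θ in (0:ℝ)..2 * Real.pi, ‖f (circleMap 0 r θ)‖ ^ 2 ≤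
      ∫ θ in (0:ℝ)..2 * Real.pi, A * ‖g (circleMap 0 r θ)‖ ^ 2 := by
    refine intervalIntegral.integral_mono_on Real.two_pi_pos.le ?_ ?_ ?_
    · exact (((cont_circle hf h0 h1).norm.pow 2)).intervalIntegrable _ _
    · exact (continuous_const.mul ((cont_circle hg h0 h1).norm.pow 2)).intervalIntegrable _ _
    · intro θ _
      exact h _ (by simp [abs_of_nonneg h0])
  rw [intervalIntegral.integral_const_mul] at h2
  calc _ ≤ (2 * Real.pi)⁻¹ * (A * ∫ θ in (0:ℝ)..2 * Real.pi, ‖g (circleMap 0 r θ)‖ ^ 2) := by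
        gcongr
    _ = _ := by ring

lemma mean_le {f : ℂ → ℂ} (hf : MemH2 f) {r : ℝ} (h0 : 0 ≤ r) (h1 : r < 1) : mean f r ≤ h2NormSq f := by
  rw [← (parseval hf.1 h0 h1).tsum_eq]
  refine (parseval hf.1 h0 h1).summable.tsum_le_tsum (fun k => ?_) hf.2
  refine mul_le_of_le_one_right (by positivity) (pow_le_one₀ (by positivity) ?_)
  nlinarith

lemma memH2_of_mean {f : ℂ → ℂ} (hf : DifferentiableOn ℂ f unitDisk) {C : ℝ}
    (h : ∀ᶠ r in nhdsWithin (1:ℝ) (Iio 1), mean f r ≤ C) : MemH2 f ∧ h2NormSq f ≤ C := by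
  have hs : ∀ s : Finset ℕ, ∑ k ∈ s, ‖taylorCoeff f k‖ ^ 2 ≤ C := by
    intro s
    have lim : Tendsto (fun r : ℝ => ∑ k ∈ s, ‖taylorCoeff f k‖ ^ 2 * (r ^ 2) ^ k) (nhdsWithin 1 (Iio 1))
        (nhds (∑ k ∈ s, ‖taylorCoeff f k‖ ^ 2 * ((1:ℝ) ^ 2) ^ k)) := by
      refine Tendsto.mono_left (Continuous.tendsto ?_ 1) nhdsWithin_le_nhds
      fun_prop
    simp only [one_pow, mul_one] at lim
    refine le_of_tendsto lim ?_
    have e2 : ∀ᶠ r : ℝ in nhdsWithin 1 (Iio 1), 0 < r :=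
      (Filter.Eventually.filter_mono nhdsWithin_le_nhds
        ((lt_mem_nhds (show (0:ℝ) < 1 by norm_num))))
    filter_upwards [h, e2, self_mem_nhdsWithin] with r h1 h2 h3
    refine le_trans ?_ h1
    rw [← (parseval hf h2.le h3).tsum_eq]
    exact (parseval hf h2.le h3).summable.sum_le_tsum s fun k _ => by positivity
  have hsm : Summable fun k => ‖taylorCoeff f k‖ ^ 2 :=
    summable_of_sum_le (fun k => by positivity) hs
  exact ⟨⟨hf, hsm⟩, hsm.tsum_le_of_sum_le hs⟩

lemma mean_tendsto {f : ℂ → ℂ} (hf : MemH2 f) :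
    Tendsto (mean f) (nhdsWithin 1 (Iio 1)) (nhds (h2NormSq f)) := by
  have e2 : ∀ᶠ r : ℝ in nhdsWithin 1 (Iio 1), 0 < r :=
      (Filter.Eventually.filter_mono nhdsWithin_le_nhds
        ((lt_mem_nhds (show (0:ℝ) < 1 by norm_num))))
  have : Tendsto (fun r : ℝ => ∑' k, ‖taylorCoeff f k‖ ^ 2 * (r ^ 2) ^ k) (nhdsWithin 1 (Iio 1)) (nhds (h2NormSq f)) := by
    refine tendsto_tsum_of_dominated_convergence hf.2 ?_ ?_
    · intro k
      have : Tendsto (fun r : ℝ => ‖taylorCoeff f k‖ ^ 2 * (r ^ 2) ^ k) (nhdsWithin 1 (Iio 1))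
        (nhds (‖taylorCoeff f k‖ ^ 2 * ((1:ℝ) ^ 2) ^ k)) := by
        refine Tendsto.mono_left (Continuous.tendsto ?_ 1) nhdsWithin_le_nhds
        fun_prop
      simpa using this
    · filter_upwards [e2, self_mem_nhdsWithin] with r h2 h3 k
      rw [Real.norm_of_nonneg (by positivity)]
      refine mul_le_of_le_one_right (by positivity) (pow_le_one₀ (by positivity) ?_)
      simp at h3
      nlinarith
  refine this.congr' ?_
  filter_upwards [e2, self_mem_nhdsWithin] with r h2 h3
  exact (parseval hf.1 h2.le h3).tsum_eq

/-- multiplication by a bounded analytic function -/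
lemma memH2_mul {u h : ℂ → ℂ} (hu : DifferentiableOn ℂ u unitDisk) {C : ℝ} (hC : ∀ z ∈ unitDisk, ‖u z‖ ≤ C)
    (hh : MemH2 h) : MemH2 (fun z => u z * h z) ∧ h2NormSq (fun z => u z * h z) ≤ C ^ 2 * h2NormSq h := by
  have e2 : ∀ᶠ r : ℝ in nhdsWithin 1 (Iio 1), 0 < r :=
      (Filter.Eventually.filter_mono nhdsWithin_le_nhds
        ((lt_mem_nhds (show (0:ℝ) < 1 by norm_num))))
  refine memH2_of_mean (hu.mul hh.1) ?_
  filter_upwards [e2, self_mem_nhdsWithin] with r h2 h3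
  refine (mean_mono_congr (hu.mul hh.1) hh.1 h2.le h3 (A := C ^ 2) ?_).trans ?_
  · intro z hz
    rw [Pi.mul_apply, norm_mul, mul_pow]
    gcongr
    exact hC z (by rw [mem_unitDisk, hz]; exact h3)
  · gcongr
    exact mean_le hh h2.le h3

lemma memH2_const (c : ℂ) : MemH2 fun _ => c := by
  have : ∀ z ∈ unitDisk, HasSum (fun k => (if k = 0 then c else 0) * z ^ k) c := by
    intro z _
    have := hasSum_ite_eq (0:ℕ) c
    refine this.congr_fun ?_ |> id
    intro k
    by_cases h : k = 0 <;> simp [h]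
  obtain ⟨h1, h2⟩ := taylor_of_hasSum this
  refine ⟨h1, ?_⟩
  refine summable_of_ne_finset_zero (s := {0}) fun k hk => ?_
  simp at hk
  simp [h2, hk]

lemma memH2_of_bdd {u : ℂ → ℂ} (hu : DifferentiableOn ℂ u unitDisk) {C : ℝ} (hC : ∀ z ∈ unitDisk, ‖u z‖ ≤ C) :
    MemH2 u := by
  simpa using (memH2_mul hu hC (memH2_const 1)).1

lemma poly_bdd (p : Polynomial ℂ) : ∃ C, ∀ z ∈ unitDisk, ‖p.eval z‖ ≤ C := by
  obtain ⟨M, hM⟩ := (isCompact_closedBall (0:ℂ) 1).exists_bound_of_continuousOn p.continuous.continuousOn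
  exact ⟨M, fun z hz => hM z (Metric.ball_subset_closedBall hz)⟩

lemma memH2_poly (p : Polynomial ℂ) : MemH2 fun z => p.eval z := by
  obtain ⟨C, hC⟩ := poly_bdd p
  exact memH2_of_bdd p.differentiable.differentiableOn hC

/-- isometry for bounded functions -/
lemma inner_isometry_bdd {f h : ℂ → ℂ} (hf : MemBallHinf f)
    (hIinner : ∀ᵐ (θ : ℝ) ∂(volume.restrict (Set.Ioc (0:ℝ) (2 * Real.pi))),
      ‖bdryVal f (Complex.exp (θ * Complex.I))‖ = 1)
    (hh : DifferentiableOn ℂ h unitDisk) {C : ℝ} (hC : ∀ z ∈ unitDisk, ‖h z‖ ≤ C) :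
    h2NormSq (fun z => f z * h z) = h2NormSq h := by
  have hh2 := memH2_of_bdd hh hC
  have hfh := (memH2_mul hf.1 hf.2 hh2).1
  have t1 := mean_tendsto hfh
  have t2 := mean_tendsto hh2
  have hr := inner_radial hf hIinner
  have e2 : ∀ᶠ r : ℝ in nhdsWithin 1 (Iio 1), 0 < r :=
      (Filter.Eventually.filter_mono nhdsWithin_le_nhds
        ((lt_mem_nhds (show (0:ℝ) < 1 by norm_num))))
  have t3 : Tendsto (fun r => mean h r - mean (fun z => f z * h z) r) (nhdsWithin 1 (Iio 1)) (nhds 0) := by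
    have t4 : Tendsto (fun r => (2 * Real.pi)⁻¹ * ∫ θ in (0:ℝ)..2 * Real.pi,
        (1 - ‖f (circleMap 0 r θ)‖ ^ 2) * ‖h (circleMap 0 r θ)‖ ^ 2) (nhdsWithin 1 (Iio 1))
        (nhds ((2 * Real.pi)⁻¹ * ∫ θ in (0:ℝ)..2 * Real.pi, (0:ℝ))) := by
      refine Tendsto.const_mul _ ?_
      refine intervalIntegral.tendsto_integral_filter_of_dominated_convergence (fun _ => C ^ 2) ?_ ?_ ?_ ?_
      · filter_upwards [e2, self_mem_nhdsWithin] with r h2 h3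
        exact ((continuous_const.sub ((cont_circle hf.1 h2.le h3).norm.pow 2)).mul
          ((cont_circle hh h2.le h3).norm.pow 2)).aestronglyMeasurable
      · filter_upwards [e2, self_mem_nhdsWithin] with r h2 h3
        refine Eventually.of_forall fun θ _ => ?_
        have hm := circleMap_mem h2.le h3 θ
        have a1 := hf.2 _ hm
        have a2 := hC _ hm
        have a3 : ‖f (circleMap 0 r θ)‖ ^ 2 ≤ 1 := pow_le_one₀ (norm_nonneg _) a1
        rw [Real.norm_of_nonneg (mul_nonneg (by linarith) (by positivity))]
        calc _ ≤ 1 * ‖h (circleMap 0 r θ)‖ ^ 2 := by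
              gcongr
              have : 0 ≤ ‖f (circleMap 0 r θ)‖ ^ 2 := by positivity
              linarith
          _ ≤ C ^ 2 := by rw [one_mul]; gcongr
      · simp
      · rw [← ae_restrict_iff' measurableSet_uIoc, uIoc_of_le Real.two_pi_pos.le]
        filter_upwards [hr] with θ hθ
        have h1 : Tendsto (fun r => (1 - ‖f (circleMap 0 r θ)‖ ^ 2) * C ^ 2) (nhdsWithin 1 (Iio 1)) (nhds 0) := by
          have := ((hθ.pow 2).const_sub 1).mul_const (C ^ 2)
          simpa using this
        refine squeeze_zero' ?_ ?_ h1
        · filter_upwards [e2, self_mem_nhdsWithin] with r h2 h3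
          have a3 : ‖f (circleMap 0 r θ)‖ ^ 2 ≤ 1 := pow_le_one₀ (norm_nonneg _) (hf.2 _ (circleMap_mem h2.le h3 θ))
          exact mul_nonneg (by linarith) (by positivity)
        · filter_upwards [e2, self_mem_nhdsWithin] with r h2 h3
          have a3 : ‖f (circleMap 0 r θ)‖ ^ 2 ≤ 1 := pow_le_one₀ (norm_nonneg _) (hf.2 _ (circleMap_mem h2.le h3 θ))
          have a4 : 0 ≤ 1 - ‖f (circleMap 0 r θ)‖ ^ 2 := by linarith
          have := hC _ (circleMap_mem h2.le h3 θ)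
          gcongr
    simp only [intervalIntegral.integral_zero, mul_zero] at t4
    refine t4.congr' ?_
    filter_upwards [e2, self_mem_nhdsWithin] with r h2 h3
    unfold mean
    rw [← mul_sub, ← intervalIntegral.integral_sub]
    · congr 1
      refine intervalIntegral.integral_congr fun θ _ => ?_
      simp only [norm_mul]; ring
    · exact (((cont_circle hh h2.le h3).norm.pow 2)).intervalIntegrable _ _
    · exact (((cont_circle hfh.1 h2.le h3).norm.pow 2)).intervalIntegrable _ _
  have := tendsto_nhds_unique (t2.sub t1) t3
  linarith

abbrev L2 : Type := lp (fun _ : ℕ => ℂ) 2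

def mkE (c : ℕ → ℂ) (h : Summable fun k => ‖c k‖ ^ 2) : L2 :=
  ⟨c, memℓp_gen (by simpa using h)⟩

lemma mkE_apply (c : ℕ → ℂ) (h : Summable fun k => ‖c k‖ ^ 2) (k : ℕ) : mkE c h k = c k := rfl

lemma L2_summable (c : L2) : Summable fun k => ‖c k‖ ^ 2 := by
  simpa using (lp.memℓp c).summable (by norm_num)

lemma L2_norm_sq (c : L2) : ‖c‖ ^ 2 = ∑' k, ‖c k‖ ^ 2 := by
  have := lp.norm_rpow_eq_tsum (p := 2) (by norm_num) c
  simpa using this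

def toE (f : ℂ → ℂ) (hf : MemH2 f) : L2 := mkE (taylorCoeff f) hf.2

lemma toE_apply {f : ℂ → ℂ} (hf : MemH2 f) (k : ℕ) : toE f hf k = taylorCoeff f k := rfl

lemma toE_norm_sq {f : ℂ → ℂ} (hf : MemH2 f) : ‖toE f hf‖ ^ 2 = h2NormSq f := by
  rw [L2_norm_sq]; rfl

lemma toE_inner {f g : ℂ → ℂ} (hf : MemH2 f) (hg : MemH2 g) :
    h2Inner f g = inner ℂ (toE f hf) (toE g hg) := by
  rw [lp.inner_eq_tsum]
  unfold h2Inner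
  refine tsum_congr fun k => ?_
  rw [toE_apply, toE_apply, RCLike.inner_apply, mul_comm]

lemma toE_congr {f g : ℂ → ℂ} (hf : MemH2 f) (hg : MemH2 g) (h : ∀ z ∈ unitDisk, f z = g z) :
    toE f hf = toE g hg := by
  ext k
  rw [toE_apply, toE_apply, taylor_congr h]

lemma h2NormSq_congr {f g : ℂ → ℂ} (h : ∀ z ∈ unitDisk, f z = g z) : h2NormSq f = h2NormSq g := by
  unfold h2NormSq
  simp only [taylor_congr h]

lemma h2Inner_congr {f g f' g' : ℂ → ℂ} (h : ∀ z ∈ unitDisk, f z = g z) (h' : ∀ z ∈ unitDisk, f' z = g' z) :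
    h2Inner f f' = h2Inner g g' := by
  unfold h2Inner
  simp only [taylor_congr h, taylor_congr h']

lemma memH2_congr {f g : ℂ → ℂ} (h : ∀ z ∈ unitDisk, f z = g z) (hf : MemH2 f) : MemH2 g := by
  refine ⟨hf.1.congr fun z hz => (h z hz).symm, ?_⟩
  have := hf.2
  simpa only [taylor_congr h] using this

def fn (c : L2) (z : ℂ) : ℂ := ∑' k, c k * z ^ k

lemma fn_hasSum (c : L2) {z : ℂ} (hz : z ∈ unitDisk) : HasSum (fun k => c k * z ^ k) (fn c z) := by
  rw [mem_unitDisk] at hz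
  refine Summable.hasSum ?_
  refine Summable.of_norm_bounded (g := fun k => ‖c‖ * ‖z‖ ^ k)
    ((summable_geometric_of_lt_one (norm_nonneg _) hz).mul_left _) fun k => ?_
  rw [norm_mul, norm_pow]
  gcongr
  exact lp.norm_apply_le_norm (by norm_num) c k

lemma memH2_fn (c : L2) : MemH2 (fn c) := by
  obtain ⟨h1, h2⟩ := taylor_of_hasSum (fun z hz => fn_hasSum c hz)
  refine ⟨h1, ?_⟩
  simp only [h2]
  exact L2_summable c

lemma toE_fn (c : L2) : toE (fn c) (memH2_fn c) = c := by
  obtain ⟨h1, h2⟩ := taylor_of_hasSum (fun z hz => fn_hasSum c hz)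
  ext k
  rw [toE_apply, h2]

lemma fn_toE {f : ℂ → ℂ} (hf : MemH2 f) {z : ℂ} (hz : z ∈ unitDisk) : fn (toE f hf) z = f z :=
  (fn_hasSum _ hz).unique (taylor_hasSum hf.1 hz)

lemma fn_add (c d : L2) {z : ℂ} (hz : z ∈ unitDisk) : fn (c + d) z = fn c z + fn d z := by
  refine (fn_hasSum _ hz).unique (((fn_hasSum c hz).add (fn_hasSum d hz)).congr_fun fun k => ?_)
  simp [add_mul]

lemma fn_smul (a : ℂ) (c : L2) {z : ℂ} (hz : z ∈ unitDisk) : fn (a • c) z = a * fn c z := by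
  refine (fn_hasSum _ hz).unique (((fn_hasSum c hz).mul_left a).congr_fun fun k => ?_)
  simp [mul_assoc]

lemma fn_sub (c d : L2) {z : ℂ} (hz : z ∈ unitDisk) : fn (c - d) z = fn c z - fn d z := by
  refine (fn_hasSum _ hz).unique (((fn_hasSum c hz).sub (fn_hasSum d hz)).congr_fun fun k => ?_)
  simp [sub_mul]

lemma toE_eq {f : ℂ → ℂ} (hf : MemH2 f) {c : L2} (h : ∀ z ∈ unitDisk, f z = fn c z) : toE f hf = c := by
  rw [← toE_fn c]
  exact toE_congr _ _ h

lemma memH2_sub {f g : ℂ → ℂ} (hf : MemH2 f) (hg : MemH2 g) : MemH2 (fun z => f z - g z) := by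
  refine memH2_congr (f := fn (toE f hf - toE g hg)) (fun z hz => ?_) (memH2_fn _)
  rw [fn_sub _ _ hz, fn_toE _ hz, fn_toE _ hz]

lemma toE_sub {f g : ℂ → ℂ} (hf : MemH2 f) (hg : MemH2 g) :
    toE (fun z => f z - g z) (memH2_sub hf hg) = toE f hf - toE g hg := by
  refine toE_eq _ fun z hz => ?_
  rw [fn_sub _ _ hz, fn_toE _ hz, fn_toE _ hz]

lemma memH2_add {f g : ℂ → ℂ} (hf : MemH2 f) (hg : MemH2 g) : MemH2 (fun z => f z + g z) := by
  refine memH2_congr (f := fn (toE f hf + toE g hg)) (fun z hz => ?_) (memH2_fn _)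
  rw [fn_add _ _ hz, fn_toE _ hz, fn_toE _ hz]

lemma taylor_poly (P : Polynomial ℂ) (k : ℕ) : taylorCoeff (fun z => P.eval z) k = P.coeff k := by
  refine (taylor_of_hasSum fun z _ => ?_).2 k
  rw [Polynomial.eval_eq_sum]
  refine hasSum_sum_of_ne_finset_zero fun b hb => ?_
  rw [Polynomial.mem_support_iff, not_not] at hb
  simp [hb]

lemma h2_growth {g : ℂ → ℂ} (hg : MemH2 g) {z : ℂ} (hz : z ∈ unitDisk) :
    ‖g z‖ ^ 2 * (1 - ‖z‖ ^ 2) ≤ h2NormSq g := by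
  have hz' := mem_unitDisk.1 hz
  have hz2 : ‖z‖ ^ 2 < 1 := by nlinarith [norm_nonneg z]
  have hgeo : HasSum (fun k : ℕ => ‖((starRingEnd ℂ) z) ^ k‖ ^ 2) (1 - ‖z‖ ^ 2)⁻¹ := by
    refine (hasSum_geometric_of_lt_one (by positivity) hz2).congr_fun fun k => ?_
    rw [norm_pow, RCLike.norm_conj]; ring
  set K : L2 := mkE (fun k => ((starRingEnd ℂ) z) ^ k) hgeo.summable with hK
  have hKn : ‖K‖ ^ 2 = (1 - ‖z‖ ^ 2)⁻¹ := by
    rw [L2_norm_sq]; exact hgeo.tsum_eq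
  have hin : inner ℂ K (toE g hg) = g z := by
    rw [lp.inner_eq_tsum, ← (taylor_hasSum hg.1 hz).tsum_eq]
    refine tsum_congr fun k => ?_
    rw [toE_apply, hK, mkE_apply, RCLike.inner_apply]
    simp
  have hcs := norm_inner_le_norm (𝕜 := ℂ) K (toE g hg)
  rw [hin] at hcs
  have h3 : ‖g z‖ ^ 2 ≤ (1 - ‖z‖ ^ 2)⁻¹ * h2NormSq g := by
    rw [← toE_norm_sq hg, ← hKn, ← mul_pow]
    gcongr
  have h4 : 0 < 1 - ‖z‖ ^ 2 := by linarith
  calc _ ≤ ((1 - ‖z‖ ^ 2)⁻¹ * h2NormSq g) * (1 - ‖z‖ ^ 2) := by gcongr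
    _ = _ := by field_simp

lemma memH2_I {I h : ℂ → ℂ} (hI : MemBallHinf I) (hh : MemH2 h) : MemH2 (fun z => I z * h z) :=
  (memH2_mul hI.1 hI.2 hh).1

def mulOp (I : ℂ → ℂ) (hI : MemBallHinf I) : L2 →L[ℂ] L2 :=
  LinearMap.mkContinuous
    { toFun := fun c => toE (fun z => I z * fn c z) (memH2_I hI (memH2_fn c))
      map_add' := fun c d => by
        refine toE_eq _ fun z hz => ?_
        rw [fn_add c d hz, fn_add _ _ hz, fn_toE _ hz, fn_toE _ hz]; ring
      map_smul' := fun a c => by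
        refine toE_eq _ fun z hz => ?_
        rw [RingHom.id_apply, fn_smul a c hz, fn_smul _ _ hz, fn_toE _ hz]; ring } 1
    (fun c => by
      have := (memH2_mul hI.1 hI.2 (memH2_fn c)).2
      rw [← toE_norm_sq (memH2_I hI (memH2_fn c)), ← toE_norm_sq (memH2_fn c), toE_fn,
        ← mul_pow] at this
      exact (sq_le_sq₀ (norm_nonneg _) (by positivity)).1 this)

lemma mulOp_apply {I : ℂ → ℂ} (hI : MemBallHinf I) (c : L2) :
    mulOp I hI c = toE (fun z => I z * fn c z) (memH2_I hI (memH2_fn c)) := rfl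

lemma fn_mulOp {I : ℂ → ℂ} (hI : MemBallHinf I) (c : L2) {z : ℂ} (hz : z ∈ unitDisk) :
    fn (mulOp I hI c) z = I z * fn c z := by
  rw [mulOp_apply, fn_toE _ hz]

lemma mulOp_isometry {I : ℂ → ℂ} (hI : MemBallHinf I)
    (hIinner : ∀ᵐ (θ : ℝ) ∂(volume.restrict (Set.Ioc (0:ℝ) (2 * Real.pi))),
      ‖bdryVal I (Complex.exp (θ * Complex.I))‖ = 1) (c : L2) : ‖mulOp I hI c‖ = ‖c‖ := by
  have hs := lp.hasSum_single (p := 2) (by norm_num) c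
  have h1 : Tendsto (fun s : Finset ℕ => ‖mulOp I hI (∑ k ∈ s, lp.single 2 k (c k))‖) atTop
      (nhds ‖mulOp I hI c‖) := (((mulOp I hI).continuous.tendsto _).comp hs).norm
  have h2 : Tendsto (fun s : Finset ℕ => ‖∑ k ∈ s, lp.single 2 k (c k)‖) atTop
      (nhds ‖c‖) := Tendsto.norm hs
  refine tendsto_nhds_unique h1 (h2.congr fun s => ?_)
  set P : Polynomial ℂ := ∑ k ∈ s, Polynomial.C (c k) * Polynomial.X ^ k with hP
  set d : L2 := ∑ k ∈ s, lp.single 2 k (c k) with hd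
  have e1 : toE (fun z => P.eval z) (memH2_poly P) = d := by
    ext i
    rw [toE_apply, taylor_poly, hd, lp.coeFn_sum, Finset.sum_apply, hP, Polynomial.finsetSum_coeff]
    refine Finset.sum_congr rfl fun k _ => ?_
    rw [Polynomial.coeff_C_mul_X_pow]
    by_cases h : i = k
    · subst h; simp
    · simp [h]
  have e2 : ∀ z ∈ unitDisk, P.eval z = fn d z := fun z hz => by
    rw [← e1, fn_toE _ hz]
  obtain ⟨C, hC⟩ := poly_bdd P
  have e3 := inner_isometry_bdd hI hIinner P.differentiable.differentiableOn hC
  rw [← toE_norm_sq (memH2_poly P), e1,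
    h2NormSq_congr (g := fun z => I z * fn d z) (fun z hz => by rw [e2 z hz]),
    ← toE_norm_sq (memH2_I hI (memH2_fn d)), ← mulOp_apply] at e3
  exact ((sq_eq_sq₀ (norm_nonneg _) (norm_nonneg _)).1 e3).symm

lemma mulOp_closed {I : ℂ → ℂ} (hI : MemBallHinf I)
    (hIinner : ∀ᵐ (θ : ℝ) ∂(volume.restrict (Set.Ioc (0:ℝ) (2 * Real.pi))),
      ‖bdryVal I (Complex.exp (θ * Complex.I))‖ = 1) : IsClosed (range (mulOp I hI)) := by
  have : Isometry (mulOp I hI) :=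
    AddMonoidHomClass.isometry_of_norm _ (mulOp_isometry hI hIinner)
  exact this.isClosedEmbedding.isClosed_range

lemma root_of_growth {ξ : ℂ} (hξ : ‖ξ‖ = 1) {B g : ℂ → ℂ} {C : ℝ} (hB : ∀ z ∈ unitDisk, ‖B z‖ ≤ C) (hg : MemH2 g)
    {q : Polynomial ℂ} (h : ∀ z ∈ unitDisk, (z - ξ) * B z * g z = q.eval z) : q.eval ξ = 0 := by
  have hlim : Tendsto (fun r : ℝ => ‖q.eval ((r:ℂ) * ξ)‖ ^ 2) (nhdsWithin 1 (Iio 1))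
      (nhds (‖q.eval (((1:ℝ):ℂ) * ξ)‖ ^ 2)) := by
    refine Tendsto.mono_left (Continuous.tendsto ?_ 1) nhdsWithin_le_nhds
    have := q.continuous
    fun_prop
  have hlim0 : Tendsto (fun r : ℝ => (1 - r) * (C ^ 2 * h2NormSq g)) (nhdsWithin 1 (Iio 1))
      (nhds ((1 - 1) * (C ^ 2 * h2NormSq g))) := by
    refine Tendsto.mono_left (Continuous.tendsto ?_ 1) nhdsWithin_le_nhds
    fun_prop
  rw [sub_self, zero_mul] at hlim0
  have e2 : ∀ᶠ r : ℝ in nhdsWithin 1 (Iio 1), 0 < r :=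
      (Filter.Eventually.filter_mono nhdsWithin_le_nhds
        ((lt_mem_nhds (show (0:ℝ) < 1 by norm_num))))
  have hz : Tendsto (fun r : ℝ => ‖q.eval ((r:ℂ) * ξ)‖ ^ 2) (nhdsWithin 1 (Iio 1)) (nhds 0) := by
    refine squeeze_zero' (Eventually.of_forall fun r => by positivity) ?_ hlim0
    filter_upwards [e2, self_mem_nhdsWithin] with r h2 h3
    simp only [mem_Iio] at h3
    have hn : ‖(r:ℂ) * ξ‖ = r := by simp [hξ, abs_of_pos h2]
    have hm : (r:ℂ) * ξ ∈ unitDisk := by rw [mem_unitDisk, hn]; exact h3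
    have hd : ‖(r:ℂ) * ξ - ξ‖ = 1 - r := by
      have : (r:ℂ) * ξ - ξ = ((r - 1 : ℝ) : ℂ) * ξ := by push_cast; ring
      rw [this, norm_mul, hξ, mul_one, Complex.norm_real, Real.norm_eq_abs, abs_sub_comm, abs_of_pos (by linarith)]
    have hgr := h2_growth hg hm
    rw [hn] at hgr
    rw [← h _ hm, norm_mul, norm_mul, hd]
    have hBB := hB _ hm
    set G := ‖g ((r:ℂ) * ξ)‖ ^ 2 with hG
    have hG0 : 0 ≤ G := by positivity
    have h5 : G * (1 - r) ≤ h2NormSq g := by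
      refine le_trans ?_ hgr
      gcongr
      nlinarith
    have h6 : ‖B ((r:ℂ) * ξ)‖ ^ 2 ≤ C ^ 2 := by gcongr
    have h7 : 0 < 1 - r := by linarith
    calc ((1 - r) * ‖B ((r:ℂ) * ξ)‖ * ‖g ((r:ℂ) * ξ)‖) ^ 2 = (1 - r) * (‖B ((r:ℂ) * ξ)‖ ^ 2 * (G * (1 - r))) := by
          rw [hG]; ring
      _ ≤ _ := by gcongr
  have := tendsto_nhds_unique hlim hz
  simpa using this

lemma poly_unique (A : Multiset ℂ) (hA : ∀ ξ ∈ A, ‖ξ‖ = 1) : ∀ {g : ℂ → ℂ} (_ : MemH2 g)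
    {q : Polynomial ℂ} (_ : q.degree < (Multiset.card A : WithBot ℕ))
    (_ : ∀ z ∈ unitDisk, (A.map (fun ξ => z - ξ)).prod * g z = q.eval z), q = 0 := by
  induction A using Multiset.induction_on with
  | empty =>
    intro g hg q hq h
    simpa using hq
  | cons ξ A ih =>
    intro g hg q hq h
    have hξ := hA ξ (by simp)
    obtain ⟨C, hC⟩ := poly_bdd (A.map (fun ξ => Polynomial.X - Polynomial.C ξ)).prod
    have hev : ∀ z, (A.map (fun ξ => Polynomial.X - Polynomial.C ξ)).prod.eval z = (A.map (fun ξ => z - ξ)).prod := by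
      intro z
      rw [Polynomial.eval_multiset_prod, Multiset.map_map]
      simp
    simp only [hev] at hC
    simp only [Multiset.map_cons, Multiset.prod_cons] at h
    have hr := root_of_growth hξ hC hg h
    obtain ⟨p, hp⟩ := Polynomial.dvd_iff_isRoot.2 hr
    have : p = 0 := by
      refine ih (fun η hη => hA η (by simp [hη])) hg (q := p) ?_ ?_
      · rw [hp, Polynomial.degree_mul, Polynomial.degree_X_sub_C, Multiset.card_cons] at hq
        push_cast at hq
        rw [add_comm] at hq
        exact lt_of_add_lt_add_right hq
      · intro z hz
        have h1 := h z hz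
        rw [hp, Polynomial.eval_mul, mul_assoc] at h1
        simp only [Polynomial.eval_sub, Polynomial.eval_X, Polynomial.eval_C] at h1
        refine mul_left_cancel₀ ?_ h1
        intro h0
        rw [sub_eq_zero] at h0
        rw [mem_unitDisk, h0, hξ] at hz
        exact lt_irrefl _ hz
    rw [hp, this, mul_zero]

lemma a1_ne {n : ℕ} {ξ : Fin n → ℂ} {m : Fin n → ℕ} (hξ : ∀ j, ξ j ∈ unitCircle) {z : ℂ} (hz : z ∈ unitDisk) :
    a1fun ξ m z ≠ 0 := by
  unfold a1fun
  refine Finset.prod_ne_zero_iff.2 fun j _ => pow_ne_zero _ fun h0 => ?_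
  have := hξ j
  rw [sub_eq_zero] at h0
  rw [mem_unitDisk, h0] at hz
  simp [unitCircle] at this
  rw [this] at hz
  exact lt_irrefl _ hz

lemma a1_unique {n : ℕ} {ξ : Fin n → ℂ} {m : Fin n → ℕ} (hξ : ∀ j, ξ j ∈ unitCircle) {g : ℂ → ℂ}
    (hg : MemH2 g) {q : Polynomial ℂ} (hq : q.degree < ((∑ j, m j : ℕ) : WithBot ℕ))
    (h : ∀ z ∈ unitDisk, a1fun ξ m z * g z = q.eval z) : q = 0 := by
  refine poly_unique ((Finset.univ : Finset (Fin n)).val.bind fun j => Multiset.replicate (m j) (ξ j)) ?_ hg ?_ ?_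
  · intro η hη
    simp only [Multiset.mem_bind] at hη
    obtain ⟨j, _, hj⟩ := hη
    rw [Multiset.eq_of_mem_replicate hj]
    simpa [unitCircle] using hξ j
  · convert hq using 2
    simp [Multiset.card_bind, List.sum_ofFn]
  · intro z hz
    rw [← h z hz]
    congr 1
    rw [Multiset.map_bind, Multiset.prod_bind]
    simp [a1fun, List.prod_ofFn]

lemma decomp_unique {n : ℕ} {ξ : Fin n → ℂ} {m : Fin n → ℕ} (hξ : ∀ j, ξ j ∈ unitCircle) {f g g' : ℂ → ℂ}
    {q q' : Polynomial ℂ} (h : HbDecompOf ξ m f g q) (h' : HbDecompOf ξ m f g' q') :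
    q = q' ∧ ∀ z ∈ unitDisk, g z = g' z := by
  have hqq : q' - q = 0 := by
    refine a1_unique (m := m) hξ (memH2_sub h.1 h'.1) ?_ ?_
    · exact lt_of_le_of_lt (Polynomial.degree_sub_le _ _) (max_lt h'.2.1 h.2.1)
    · intro z hz
      have e1 := h.2.2 z hz
      have e2 := h'.2.2 z hz
      rw [Polynomial.eval_sub]
      linear_combination e2 - e1
  rw [sub_eq_zero] at hqq
  refine ⟨hqq.symm, fun z hz => ?_⟩
  have e1 := h.2.2 z hz
  have e2 := h'.2.2 z hz
  rw [hqq] at e2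
  refine mul_left_cancel₀ (a1_ne (m := m) hξ hz) ?_
  linear_combination e2 - e1

lemma hbDecomp_spec {n : ℕ} {ξ : Fin n → ℂ} {m : Fin n → ℕ} {f g : ℂ → ℂ} {q : Polynomial ℂ}
    (h : HbDecompOf ξ m f g q) : HbDecompOf ξ m f (hbDecomp ξ m f).1 (hbDecomp ξ m f).2 := by
  have hm : MemHb ξ m f := ⟨(g, q), h⟩
  rw [hbDecomp, dif_pos hm]
  exact hm.choose_spec

lemma hbNormSq_eq {n : ℕ} {ξ : Fin n → ℂ} {m : Fin n → ℕ} (hξ : ∀ j, ξ j ∈ unitCircle) {f g : ℂ → ℂ}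
    {q : Polynomial ℂ} (h : HbDecompOf ξ m f g q) :
    hbNormSq ξ m f = h2NormSq g + h2NormSq fun z => q.eval z := by
  obtain ⟨h1, h2⟩ := decomp_unique hξ (hbDecomp_spec h) h
  rw [hbNormSq, h1, h2NormSq_congr h2]

lemma hbInner_eq {n : ℕ} {ξ : Fin n → ℂ} {m : Fin n → ℕ} (hξ : ∀ j, ξ j ∈ unitCircle) {f g f' g' : ℂ → ℂ}
    {q q' : Polynomial ℂ} (h : HbDecompOf ξ m f g q) (h' : HbDecompOf ξ m f' g' q') :
    hbInner ξ m f f' = h2Inner g g' + h2Inner (fun z => q.eval z) (fun z => q'.eval z) := by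
  obtain ⟨h1, h2⟩ := decomp_unique hξ (hbDecomp_spec h) h
  obtain ⟨h1', h2'⟩ := decomp_unique hξ (hbDecomp_spec h') h'
  rw [hbInner, h1, h1', h2Inner_congr h2 h2']

lemma closed_aux {n : ℕ} {ξ : Fin n → ℂ} {m : Fin n → ℕ} (hξ : ∀ j, ξ j ∈ unitCircle) {f g : ℂ → ℂ}
    {q : Polynomial ℂ} (h : HbDecompOf ξ m f g q) {S : Set L2} (hS : IsClosed S)
    (hap : ∀ ε > (0:ℝ), ∃ u : ℂ → ℂ, (∃ c ∈ S, ∀ z ∈ unitDisk, u z = a1fun ξ m z * fn c z) ∧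
      hbNormSq ξ m (fun z => f z - u z) < ε) :
    q = 0 ∧ toE g h.1 ∈ S := by
  have key : ∀ ε > (0:ℝ), ∃ c ∈ S, ‖toE g h.1 - c‖ ^ 2 + h2NormSq (fun z => q.eval z) < ε := by
    intro ε hε
    obtain ⟨u, ⟨c, hc, hu⟩, hlt⟩ := hap ε hε
    refine ⟨c, hc, ?_⟩
    have hd : HbDecompOf ξ m (fun z => f z - u z) (fun z => g z - fn c z) q := by
      refine ⟨memH2_sub h.1 (memH2_fn c), h.2.1, fun z hz => ?_⟩
      simp only [h.2.2 z hz, hu z hz]; ring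
    rw [hbNormSq_eq hξ hd, ← toE_norm_sq (memH2_sub h.1 (memH2_fn c)), toE_sub h.1 (memH2_fn c), toE_fn] at hlt
    exact hlt
  have hq0 : h2NormSq (fun z => q.eval z) ≤ 0 := by
    refine le_of_forall_pos_le_add fun ε hε => ?_
    obtain ⟨c, -, hc⟩ := key ε hε
    nlinarith [sq_nonneg ‖toE g h.1 - c‖]
  constructor
  · have h1 : toE _ (memH2_poly q) = 0 := by
      rw [← toE_norm_sq (memH2_poly q)] at hq0
      have : ‖toE _ (memH2_poly q)‖ = 0 := by nlinarith [norm_nonneg (toE _ (memH2_poly q))]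
      exact norm_eq_zero.1 this
    ext k
    rw [← taylor_poly, ← toE_apply (memH2_poly q), h1]; simp
  · rw [← hS.closure_eq, Metric.mem_closure_iff]
    intro ε hε
    obtain ⟨c, hc, hlt⟩ := key (ε ^ 2) (by positivity)
    refine ⟨c, hc, ?_⟩
    rw [dist_eq_norm]
    have : 0 ≤ h2NormSq (fun z => q.eval z) := tsum_nonneg fun k => by positivity
    exact lt_of_pow_lt_pow_left₀ 2 hε.le (by linarith)

lemma memKI_iff {I h : ℂ → ℂ} (hI : MemBallHinf I) (hh : MemH2 h) :
    MemKI I h ↔ ∀ d : L2, inner ℂ (mulOp I hI d) (toE h hh) = 0 := by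
  constructor
  · intro hk d
    rw [mulOp_apply, ← toE_inner]
    exact hk.2 _ (memH2_fn d)
  · intro hk
    refine ⟨hh, fun g hg => ?_⟩
    rw [toE_inner (memH2_I hI hg) hh, ← hk (toE g hg), mulOp_apply]
    congr 1
    exact toE_congr _ _ fun z hz => by rw [fn_toE _ hz]

lemma isClosed_KI {I : ℂ → ℂ} (hI : MemBallHinf I) :
    IsClosed {c : L2 | ∀ d : L2, inner ℂ (mulOp I hI d) c = 0} := by
  rw [ofPred_forall]
  exact isClosed_iInter fun d => isClosed_eq (by fun_prop) continuous_const

lemma h2_div {g : ℂ → ℂ} (hg : MemH2 g) {lam : ℂ} (hl : lam ∈ unitDisk) :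
    ∃ h, MemH2 h ∧ ∀ z ∈ unitDisk, g z = g lam + (z - lam) * h z := by
  have hd : DifferentiableOn ℂ (dslope g lam) unitDisk :=
    (Complex.differentiableOn_dslope (isOpen_unitDisk.mem_nhds hl)).2 hg.1
  have hs : ∀ z, g z = g lam + (z - lam) * dslope g lam z := by
    intro z
    have := sub_smul_dslope g lam z
    rw [smul_eq_mul] at this
    rw [this]; ring
  have hg0 := memH2_sub hg (memH2_const (g lam))
  rw [mem_unitDisk] at hl
  set ρ := (1 + ‖lam‖) / 2 with hρ
  have hρ1 : ρ < 1 := by rw [hρ]; linarith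
  have hρ2 : ‖lam‖ < ρ := by rw [hρ]; linarith
  refine ⟨dslope g lam, (memH2_of_mean hd (C := (ρ - ‖lam‖)⁻¹ ^ 2 * h2NormSq (fun z => g z - g lam)) ?_).1,
    fun z _ => hs z⟩
  have e2 : ∀ᶠ r : ℝ in nhdsWithin 1 (Iio 1), ρ < r :=
      (Filter.Eventually.filter_mono nhdsWithin_le_nhds ((lt_mem_nhds hρ1)))
  filter_upwards [e2, self_mem_nhdsWithin] with r h2 h3
  have hr0 : 0 ≤ r := (norm_nonneg lam).trans (hρ2.trans h2).le
  refine (mean_mono_congr hd hg0.1 hr0 h3 (A := (ρ - ‖lam‖)⁻¹ ^ 2) ?_).trans ?_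
  · intro z hz
    have h5 : g z - g lam = (z - lam) * dslope g lam z := by rw [hs z]; ring
    rw [h5, norm_mul, ← mul_pow]
    have h6 : ρ - ‖lam‖ ≤ ‖z - lam‖ := by
      have := norm_sub_norm_le z lam
      rw [hz] at this
      linarith
    have h7 : 0 < ρ - ‖lam‖ := by linarith
    gcongr
    rw [← mul_assoc]
    refine le_mul_of_one_le_left (norm_nonneg _) ?_
    rw [inv_mul_eq_div, one_le_div h7]
    exact h6
  · gcongr
    exact mean_le hg0 hr0 h3

lemma h2_div_prod : ∀ (k : ℕ) (lam : Fin k → ℂ), (∀ i, lam i ∈ unitDisk) → ∀ {g : ℂ → ℂ}, MemH2 g →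
    ∃ (r : Polynomial ℂ) (h : ℂ → ℂ), r.degree < (k : WithBot ℕ) ∧ MemH2 h ∧
      ∀ z ∈ unitDisk, g z = r.eval z + (∏ i, (z - lam i)) * h z := by
  intro k
  induction k with
  | zero =>
    intro lam _ g hg
    exact ⟨0, g, by simp, hg, fun z _ => by simp⟩
  | succ k ih =>
    intro lam hl g hg
    obtain ⟨h1, hh1, e1⟩ := h2_div hg (hl 0)
    obtain ⟨r, h, hr, hh, e⟩ := ih (fun i => lam i.succ) (fun i => hl _) hh1
    refine ⟨Polynomial.C (g (lam 0)) + (Polynomial.X - Polynomial.C (lam 0)) * r, h, ?_, hh, ?_⟩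
    · refine lt_of_le_of_lt (Polynomial.degree_add_le _ _) (max_lt ?_ ?_)
      · refine lt_of_le_of_lt Polynomial.degree_C_le ?_
        exact_mod_cast Nat.succ_pos k
      · rw [Polynomial.degree_mul, Polynomial.degree_X_sub_C]
        by_cases h0 : r = 0
        · simp [h0]
        · rw [Polynomial.degree_eq_natDegree h0] at hr ⊢
          norm_cast at hr ⊢
          omega
    · intro z hz
      rw [e1 z hz, e z hz, Fin.prod_univ_succ]
      simp only [Polynomial.eval_add, Polynomial.eval_C, Polynomial.eval_mul, Polynomial.eval_sub,
        Polynomial.eval_X]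
      ring

lemma blaschke_div {I : ℂ → ℂ} (hB : IsFiniteBlaschke I) : ∃ k : ℕ, ∀ g : ℂ → ℂ, MemH2 g →
    ∃ (r : Polynomial ℂ) (h : ℂ → ℂ), r.degree < (k : WithBot ℕ) ∧ MemH2 h ∧
      ∀ z ∈ unitDisk, g z = r.eval z + I z * h z := by
  obtain ⟨γ, k, lam, hγ, hl, hIz⟩ := hB
  refine ⟨k, fun g hg => ?_⟩
  obtain ⟨r, h, hr, hh, e⟩ := h2_div_prod k lam hl hg
  set D : Polynomial ℂ := Polynomial.C γ⁻¹ * ∏ i, (1 - Polynomial.C ((starRingEnd ℂ) (lam i)) * Polynomial.X) with hD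
  have hDe : ∀ z, D.eval z = γ⁻¹ * ∏ i, (1 - (starRingEnd ℂ) (lam i) * z) := by
    intro z
    simp [hD, Polynomial.eval_prod]
  obtain ⟨C, hC⟩ := poly_bdd D
  refine ⟨r, fun z => D.eval z * h z, hr, (memH2_mul D.differentiable.differentiableOn hC hh).1, fun z hz => ?_⟩
  have hγ0 : γ ≠ 0 := by
    intro h0; simp [h0] at hγ
  have hne : ∏ i, (1 - (starRingEnd ℂ) (lam i) * z) ≠ 0 := by
    refine Finset.prod_ne_zero_iff.2 fun i _ h0 => ?_
    rw [sub_eq_zero] at h0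
    have h1 := congrArg norm h0
    rw [norm_mul, RCLike.norm_conj, norm_one] at h1
    have h2 := mem_unitDisk.1 (hl i)
    have h3 := mem_unitDisk.1 hz
    nlinarith [norm_nonneg z, norm_nonneg (lam i)]
  beta_reduce
  rw [e z hz, hIz z hz, hDe, Finset.prod_div_distrib]
  set Q := ∏ i, (1 - (starRingEnd ℂ) (lam i) * z)
  clear_value Q
  field_simp

lemma eval_fin {r : Polynomial ℂ} {k : ℕ} (hr : r.degree < (k : WithBot ℕ)) (z : ℂ) :
    r.eval z = ∑ i : Fin k, r.coeff i * z ^ (i:ℕ) := by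
  rw [Fin.sum_univ_eq_sum_range (fun i => r.coeff i * z ^ i) k]
  by_cases h0 : r = 0
  · simp [h0]
  · refine Polynomial.eval_eq_sum_range' ?_ z
    exact (Polynomial.natDegree_lt_iff_degree_lt h0).2 hr

/-- Lemma 2.5. For every inner function `I`, the subspaces `a₁ I H²` and
`a₁ K_I` are closed in `H(b)`, the orthogonal complement of `a₁ I H²` in `H(b)` is
`a₁ K_I ⊕ P_{N−1}`, and, when `I` is a finite Blaschke product, `a₁ I H²` has finite
codimension in `H(b)`. -/
theorem model_subspaces_in_Hb
    (b a : ℂ → ℂ) (n : ℕ) (ξ : Fin n → ℂ) (m : Fin n → ℕ)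
    (hset : RationalSetting b a n ξ m)
    (I : ℂ → ℂ) (hIball : MemBallHinf I)
    (hIinner : ∀ᵐ (θ : ℝ) ∂(volume.restrict (Set.Ioc (0:ℝ) (2 * Real.pi))),
      ‖bdryVal I (Complex.exp (θ * Complex.I))‖ = 1) :
    HbClosedSet ξ m {f | ∃ h, MemH2 h ∧ ∀ z ∈ unitDisk, f z = a1fun ξ m z * I z * h z} ∧
    HbClosedSet ξ m {f | ∃ h, MemKI I h ∧ ∀ z ∈ unitDisk, f z = a1fun ξ m z * h z} ∧
    {f | MemHb ξ m f ∧ ∀ g,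
        (∃ h, MemH2 h ∧ ∀ z ∈ unitDisk, g z = a1fun ξ m z * I z * h z) →
          hbInner ξ m f g = 0} =
      {f | ∃ (h : ℂ → ℂ) (q : Polynomial ℂ), MemKI I h ∧
        q.degree < ((∑ j, m j : ℕ) : WithBot ℕ) ∧
        ∀ z ∈ unitDisk, f z = a1fun ξ m z * h z + q.eval z} ∧
    (IsFiniteBlaschke I →
      ∃ (k : ℕ) (e : Fin k → ℂ → ℂ), ∀ f, MemHb ξ m f →
        ∃ (c : Fin k → ℂ) (h : ℂ → ℂ), MemH2 h ∧
          ∀ z ∈ unitDisk, f z = a1fun ξ m z * I z * h z + ∑ i, c i * e i z) := by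
  have hξ := hset.zeros_mem
  refine ⟨?_, ?_, ?_, ?_⟩
  · rintro f ⟨⟨g, q⟩, hd⟩ hap
    simp only at hd
    obtain ⟨hq, hg⟩ := closed_aux hξ hd (mulOp_closed hIball hIinner) (fun ε hε => by
      obtain ⟨u, ⟨h, hh, hu⟩, hlt⟩ := hap ε hε
      refine ⟨u, ⟨mulOp I hIball (toE h hh), mem_range_self _, fun z hz => ?_⟩, hlt⟩
      rw [hu z hz, fn_mulOp hIball _ hz, fn_toE _ hz, mul_assoc])
    obtain ⟨c, hc⟩ := hg
    refine ⟨fn c, memH2_fn c, fun z hz => ?_⟩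
    rw [hd.2.2 z hz, hq, ← fn_toE hd.1 hz, ← hc, fn_mulOp hIball _ hz]
    simp [mul_assoc]
  · rintro f ⟨⟨g, q⟩, hd⟩ hap
    simp only at hd
    obtain ⟨hq, hg⟩ := closed_aux hξ hd (isClosed_KI hIball) (fun ε hε => by
      obtain ⟨u, ⟨h, hh, hu⟩, hlt⟩ := hap ε hε
      refine ⟨u, ⟨toE h hh.1, (memKI_iff hIball hh.1).1 hh, fun z hz => ?_⟩, hlt⟩
      rw [hu z hz, fn_toE _ hz])
    refine ⟨g, (memKI_iff hIball hd.1).2 hg, fun z hz => ?_⟩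
    rw [hd.2.2 z hz, hq]
    simp
  · have hdec : ∀ {u h : ℂ → ℂ} (_ : MemH2 h) (_ : ∀ z ∈ unitDisk, u z = a1fun ξ m z * I z * h z),
        HbDecompOf ξ m u (fun z => I z * h z) 0 := by
      intro u h hh hu
      refine ⟨memH2_I hIball hh, ?_, fun z hz => ?_⟩
      · rw [Polynomial.degree_zero]
        exact WithBot.bot_lt_coe _
      · rw [hu z hz]; simp [mul_assoc]
    have hz0 : ∀ q : Polynomial ℂ, h2Inner (fun z => q.eval z) (fun z => (0 : Polynomial ℂ).eval z) = 0 := by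
      intro q
      unfold h2Inner
      simp only [taylor_poly]
      simp
    have hin : ∀ {f g u h : ℂ → ℂ} {q : Polynomial ℂ} (hd : HbDecompOf ξ m f g q) (hh : MemH2 h)
        (_ : ∀ z ∈ unitDisk, u z = a1fun ξ m z * I z * h z),
        hbInner ξ m f u = 0 ↔ h2Inner (fun z => I z * h z) g = 0 := by
      intro f g u h q hd hh hu
      rw [hbInner_eq hξ hd (hdec hh hu), hz0, add_zero, toE_inner hd.1 (memH2_I hIball hh),
        toE_inner (memH2_I hIball hh) hd.1, inner_eq_zero_symm]
    ext f
    constructor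
    · rintro ⟨⟨⟨g, q⟩, hd⟩, hf⟩
      simp only at hd
      refine ⟨g, q, ⟨hd.1, fun h hh => ?_⟩, hd.2⟩
      exact (hin hd hh (u := fun z => a1fun ξ m z * I z * h z) (fun z _ => rfl)).1
        (hf _ ⟨h, hh, fun z _ => rfl⟩)
    · rintro ⟨g, q, hg, hq, hf⟩
      have hd : HbDecompOf ξ m f g q := ⟨hg.1, hq, hf⟩
      refine ⟨⟨(g, q), hd⟩, ?_⟩
      rintro u ⟨h, hh, hu⟩
      exact (hin hd hh hu).2 (hg.2 h hh)
  · intro hB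
    obtain ⟨k, hk⟩ := blaschke_div hB
    refine ⟨k + ∑ j, m j, Fin.addCases (fun i z => a1fun ξ m z * z ^ (i:ℕ)) (fun i z => z ^ (i:ℕ)), ?_⟩
    rintro f ⟨⟨g, q⟩, hd⟩
    simp only at hd
    obtain ⟨r, h, hr, hh, e⟩ := hk g hd.1
    refine ⟨Fin.addCases (fun i => r.coeff i) (fun i => q.coeff i), h, hh, fun z hz => ?_⟩
    rw [Fin.sum_univ_add]
    simp only [Fin.addCases_left, Fin.addCases_right]
    rw [hd.2.2 z hz, e z hz, eval_fin hr, eval_fin hd.2.1, mul_add, Finset.mul_sum]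
    have : ∀ i : Fin k, a1fun ξ m z * (r.coeff i * z ^ (i:ℕ)) = r.coeff i * (a1fun ξ m z * z ^ (i:ℕ)) :=
      fun i => by ring
    simp only [this]
    ring

end
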